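/- arXiv:2411.17494 — 4 statements merged into one kernel-verified Lean document; each statement's English description precedes it below -/
import Mathlib

section
/- Let f ∈ K[s,t] be a nonzero homogeneous polynomial of degree d such that no nonzero homogeneous polynomial G ∈ K[s,t] of degree 3 satisfies G∘f = 0 (i.e., the point p of P^d corresponding to f has C_d-rank at least 4). Then for every K-basis h₁,…,h_d of W_f, the ideal ker φ_h ⊆ K[z₁,…,z_d] is generated by homogeneous quadratic polynomials of rank at most 4 contained in ker φ_h. (In other words, the smooth rational curve π_p(C_d) ⊂ P^{d−1} of degree d has rank index at most 4.) -/
section FrozenDefs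
open MvPolynomial

/-- The apolarity action `G ∘ f = G(∂/∂s, ∂/∂t) f` for bivariate polynomials. -/
noncomputable def apolar {K : Type*} [CommSemiring K] (G f : MvPolynomial (Fin 2) K) :
    MvPolynomial (Fin 2) K :=
  ∑ a ∈ G.support, G.coeff a • ((⇑(pderiv (0 : Fin 2)))^[a 0] ((⇑(pderiv (1 : Fin 2)))^[a 1] f))

/-- A polynomial `q` has rank at most `k` as a quadric: it is a sum of `k` squares of
linear forms. -/
def rankLE {K : Type*} [CommSemiring K] {σ : Type*} (k : ℕ) (q : MvPolynomial σ K) : Prop :=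
  ∃ ℓ : Fin k → MvPolynomial σ K, (∀ i, (ℓ i).IsHomogeneous 1) ∧ q = ∑ i, (ℓ i) ^ 2

end FrozenDefs

section PartA
open Polynomial

section Rep
variable {ι M : Type*} [CommRing M]

def IsRep (x : ι → ℕ → M) (N : ι → ℕ) (s : Multiset ι) (m : ℕ) (y : M) : Prop :=
  ∃ t : Multiset (ι × ℕ), t.map Prod.fst = s ∧ (∀ p ∈ t, p.2 ≤ N p.1) ∧
    (t.map Prod.snd).sum = m ∧ y = (t.map (fun p => x p.1 p.2)).prod

variable {x : ι → ℕ → M} {N : ι → ℕ}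

theorem IsRep.add {s s' : Multiset ι} {m m' : ℕ} {y y' : M} (h : IsRep x N s m y)
    (h' : IsRep x N s' m' y') : IsRep x N (s + s') (m + m') (y * y') := by
  obtain ⟨t, rfl, h2, rfl, rfl⟩ := h
  obtain ⟨t', rfl, h2', rfl, rfl⟩ := h'
  refine ⟨t + t', by simp, ?_, by simp, by simp⟩
  intro p hp
  rcases Multiset.mem_add.1 hp with hp | hp
  · exact h2 p hp
  · exact h2' p hp

theorem IsRep.single {c : ι} {l : ℕ} (hl : l ≤ N c) : IsRep x N {c} l (x c l) :=
  ⟨{(c, l)}, by simp, by simpa using hl, by simp, by simp⟩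

theorem isRep_zero : IsRep x N 0 0 1 := ⟨0, by simp⟩

theorem isRep_cons_iff {c : ι} {s : Multiset ι} {m : ℕ} {y : M} (h : IsRep x N (c ::ₘ s) m y) :
    ∃ l m' y', l ≤ N c ∧ m = l + m' ∧ IsRep x N s m' y' ∧ y = x c l * y' := by
  classical
  obtain ⟨t, h1, h2, rfl, rfl⟩ := h
  obtain ⟨p, hp, hpc, hp2⟩ := (Multiset.map_eq_cons _ _ _ _).2 h1
  obtain ⟨t', rfl⟩ := Multiset.exists_cons_of_mem hp
  subst hpc
  refine ⟨p.2, (t'.map Prod.snd).sum, _, h2 p hp, by simp, ⟨t', by simpa using hp2, ?_, rfl, rfl⟩, by simp⟩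
  intro q hq
  exact h2 q (Multiset.mem_cons_of_mem hq)

theorem isRep_exists (s : Multiset ι) : ∀ m, m ≤ (s.map N).sum → ∃ y, IsRep x N s m y := by
  induction s using Multiset.induction with
  | empty =>
    intro m hm
    have : m = 0 := by simpa using hm
    subst this
    exact ⟨1, isRep_zero⟩
  | cons c s ih =>
    intro m hm
    rw [Multiset.map_cons, Multiset.sum_cons] at hm
    obtain ⟨y, hy⟩ := ih (m - min m (N c)) (by omega)
    have := (IsRep.single (x := x) (N := N) (c := c) (l := min m (N c)) (by omega)).add hy
    rw [Multiset.singleton_add] at this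
    refine ⟨x c (min m (N c)) * y, ?_⟩
    convert this using 1
    omega

/-- The exchange relation. -/
def Exch (x : ι → ℕ → M) (N : ι → ℕ) : Prop :=
  ∀ c c' i j, i < N c → j < N c' → x c i * x c' (j + 1) = x c (i + 1) * x c' j

theorem IsRep.step (hx : Exch x N) {s : Multiset ι} {n : ℕ} {u : M} (h : IsRep x N s (n + 1) u)
    {c : ι} {l : ℕ} (hl : l < N c) :
    ∃ u', IsRep x N s n u' ∧ x c l * u = x c (l + 1) * u' := by
  obtain ⟨t, h1, h2, h3, rfl⟩ := h
  have : ∃ p ∈ t, p.2 ≠ 0 := by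
    by_contra hcon
    push Not at hcon
    have : (t.map Prod.snd).sum = 0 := by
      apply Multiset.sum_eq_zero
      intro a ha
      obtain ⟨p, hp, rfl⟩ := Multiset.mem_map.1 ha
      exact hcon p hp
    omega
  obtain ⟨⟨c', j'⟩, hp, hj⟩ := this
  obtain ⟨j, rfl⟩ := Nat.exists_eq_succ_of_ne_zero hj
  obtain ⟨t', rfl⟩ := Multiset.exists_cons_of_mem hp
  have hjN : j + 1 ≤ N c' := h2 _ hp
  refine ⟨_, ⟨(c', j) ::ₘ t', by simpa using h1, ?_, ?_, rfl⟩, ?_⟩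
  · intro q hq
    rcases Multiset.mem_cons.1 hq with rfl | hq
    · simp; omega
    · exact h2 q (Multiset.mem_cons_of_mem hq)
  · simp at h3 ⊢; omega
  · have := hx c c' l j hl (by omega)
    simp only [Multiset.map_cons, Multiset.prod_cons, Nat.succ_eq_add_one]
    rw [← mul_assoc, this, mul_assoc]

theorem IsRep.steps (hx : Exch x N) {s : Multiset ι} (k : ℕ) : ∀ {n : ℕ} {u : M},
    IsRep x N s (n + k) u → ∀ {c : ι} {l : ℕ}, l + k ≤ N c →
    ∃ u', IsRep x N s n u' ∧ x c l * u = x c (l + k) * u' := by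
  induction k with
  | zero => intro n u h c l hl; exact ⟨u, h, rfl⟩
  | succ k ih =>
    intro n u h c l hl
    obtain ⟨u', h', e⟩ := IsRep.step hx (n := n + k) h (c := c) (l := l) (by omega)
    obtain ⟨u'', h'', e'⟩ := ih h' (c := c) (l := l + 1) (by omega)
    exact ⟨u'', h'', by rw [e, e']; congr 2; omega⟩

theorem IsRep.unique (hx : Exch x N) {s : Multiset ι} : ∀ {m : ℕ} {y y' : M},
    IsRep x N s m y → IsRep x N s m y' → y = y' := by
  induction s using Multiset.induction with
  | empty =>
    rintro m y y' ⟨t, h1, -, -, rfl⟩ ⟨t', h1', -, -, rfl⟩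
    simp at h1 h1'
    simp [h1, h1']
  | cons c s ih =>
    intro m y y' h h'
    obtain ⟨l, n, u, hl, e, hu, rfl⟩ := isRep_cons_iff h
    obtain ⟨l', n', u', hl', e', hu', rfl⟩ := isRep_cons_iff h'
    have key : ∀ l n u l' n' u', l' ≤ N c → l + n = l' + n' → l ≤ l' → IsRep x N s n u →
        IsRep x N s n' u' → x c l * u = x c l' * u' := by
      intro l n u l' n' u' hl' e hle hu hu'
      obtain ⟨k, rfl⟩ := Nat.exists_eq_add_of_le hle
      have : n = n' + k := by omega
      subst this
      obtain ⟨u'', h'', e''⟩ := IsRep.steps hx k hu (c := c) (l := l) hl'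
      rw [e'', ih h'' hu']
    rcases le_total l l' with hle | hle
    · exact key _ _ _ _ _ _ hl' (by omega) hle hu hu'
    · exact (key _ _ _ _ _ _ hl (by omega) hle hu' hu).symm

open Classical in
noncomputable def mon (x : ι → ℕ → M) (N : ι → ℕ) (s : Multiset ι) (m : ℕ) : M :=
  if h : ∃ y, IsRep x N s m y then h.choose else 0

theorem mon_spec {s : Multiset ι} {m : ℕ} (hm : m ≤ (s.map N).sum) :
    IsRep x N s m (mon x N s m) := by
  have h := isRep_exists (x := x) s m hm
  rw [mon, dif_pos h]
  exact h.choose_spec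

theorem mon_add (hx : Exch x N) {s s' : Multiset ι} {m m' : ℕ} (hm : m ≤ (s.map N).sum)
    (hm' : m' ≤ (s'.map N).sum) : mon x N (s + s') (m + m') = mon x N s m * mon x N s' m' :=
  IsRep.unique hx (mon_spec (by simp; omega)) ((mon_spec hm).add (mon_spec hm'))

theorem mon_single (hx : Exch x N) {c : ι} {l : ℕ} (hl : l ≤ N c) : mon x N {c} l = x c l :=
  IsRep.unique hx (mon_spec (by simpa using hl)) (IsRep.single hl)

theorem mon_zero (hx : Exch x N) : mon x N 0 0 = 1 :=
  IsRep.unique hx (mon_spec (by simp)) isRep_zero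

variable {K : Type*} [Field K] [Algebra K M]

noncomputable def theta (K : Type*) [Field K] [Algebra K M] (x : ι → ℕ → M) (N : ι → ℕ)
    (s : Multiset ι) : K[X] →ₗ[K] M :=
  (Polynomial.basisMonomials K).constr K (mon x N s)

theorem theta_X_pow (s : Multiset ι) (m : ℕ) : theta K x N s (X ^ m) = mon x N s m := by
  have := (Polynomial.basisMonomials K).constr_basis K (mon x N s) m
  rw [Polynomial.coe_basisMonomials] at this
  rw [X_pow_eq_monomial]
  exact this

/-- linear maps agreeing on small powers -/
theorem linext {V : Type*} [AddCommGroup V] [Module K V] (f g : K[X] →ₗ[K] V) (n : ℕ)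
    (h : ∀ m ≤ n, f (X ^ m) = g (X ^ m)) (p : K[X]) (hp : p.natDegree ≤ n) : f p = g p := by
  rw [p.as_sum_range' (n + 1) (by omega)]
  simp only [map_sum]
  refine Finset.sum_congr rfl fun m hm => ?_
  rw [← C_mul_X_pow_eq_monomial, ← smul_eq_C_mul, map_smul, map_smul, h m]
  have := Finset.mem_range.1 hm
  omega

theorem theta_mul (hx : Exch x N) {s s' : Multiset ι} {p q : K[X]} (hp : p.natDegree ≤ (s.map N).sum)
    (hq : q.natDegree ≤ (s'.map N).sum) :
    theta K x N (s + s') (p * q) = theta K x N s p * theta K x N s' q := by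
  refine linext (theta K x N (s + s') ∘ₗ LinearMap.mulRight K q)
    (LinearMap.mulRight K (theta K x N s' q) ∘ₗ theta K x N s) _ ?_ p hp
  intro m hm
  simp only [LinearMap.comp_apply, LinearMap.mulRight_apply]
  refine linext (theta K x N (s + s') ∘ₗ LinearMap.mulLeft K (X ^ m))
    (LinearMap.mulLeft K (theta K x N s (X ^ m)) ∘ₗ theta K x N s') _ ?_ q hq
  intro m' hm'
  simp only [LinearMap.comp_apply, LinearMap.mulLeft_apply]
  rw [← pow_add, theta_X_pow, theta_X_pow, theta_X_pow, mon_add hx hm hm']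

end Rep

theorem factor_split {K : Type*} [Field K] [IsAlgClosed K] (n : ℕ) : ∀ (m : ℕ) (P : K[X]),
    P.natDegree ≤ m + n → ∃ p q : K[X], P = p * q ∧ p.natDegree ≤ m ∧ q.natDegree ≤ n := by
  intro m
  induction m with
  | zero => intro P hP; exact ⟨1, P, by simp, by simp, by omega⟩
  | succ m ih =>
    intro P hP
    by_cases h : P.natDegree ≤ n
    · exact ⟨1, P, by simp, by simp, h⟩
    have hd : P.degree ≠ 0 := by
      intro h0
      have : P.natDegree = 0 := natDegree_eq_of_degree_eq_some h0
      omega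
    obtain ⟨r, hr⟩ := IsAlgClosed.exists_root P hd
    obtain ⟨Q, hQ⟩ := dvd_iff_isRoot.2 hr
    have hQ0 : Q ≠ 0 := by
      rintro rfl
      simp at hQ
      subst hQ
      simp at h
    have hdeg : P.natDegree = 1 + Q.natDegree := by
      rw [hQ, natDegree_mul (X_sub_C_ne_zero r) hQ0, natDegree_X_sub_C]
    obtain ⟨p, q, e, hp, hq⟩ := ih Q (by omega)
    refine ⟨(X - C r) * p, q, by rw [hQ, e, mul_assoc], ?_, hq⟩
    refine natDegree_mul_le.trans ?_
    rw [natDegree_X_sub_C]; omega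

end PartA

section PartB
open Polynomial

section Core
variable {K M : Type*} [Field K] [CommRing M] [Algebra K M]

/-- The binomial relations hold for `ζ`. -/
def BinRel (E : Bool → K[X]) (N : Bool → ℕ) (ζ : K[X] →ₗ[K] M) : Prop :=
  ∀ (c₁ c₂ c₃ c₄ : Bool) (p₁ p₂ p₃ p₄ : K[X]), p₁.natDegree ≤ N c₁ → p₂.natDegree ≤ N c₂ →
    p₃.natDegree ≤ N c₃ → p₄.natDegree ≤ N c₄ →
    (E c₁ * p₁) * (E c₂ * p₂) = (E c₃ * p₃) * (E c₄ * p₄) →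
    ζ (E c₁ * p₁) * ζ (E c₂ * p₂) = ζ (E c₃ * p₃) * ζ (E c₄ * p₄)

variable {E : Bool → K[X]} {N : Bool → ℕ} {ζ : K[X] →ₗ[K] M}

theorem BinRel.exch (h : BinRel E N ζ) : Exch (fun c i => ζ (E c * X ^ i)) N := by
  intro c c' i j hi hj
  apply h
  · rw [natDegree_X_pow]; omega
  · rw [natDegree_X_pow]; omega
  · rw [natDegree_X_pow]; omega
  · rw [natDegree_X_pow]; omega
  · ring

/-- the theta map attached to `ζ` -/
noncomputable abbrev th (E : Bool → K[X]) (N : Bool → ℕ) (ζ : K[X] →ₗ[K] M) (s : Multiset Bool) :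
    K[X] →ₗ[K] M := theta K (fun c i => ζ (E c * X ^ i)) N s

theorem th_single (h : BinRel E N ζ) {c : Bool} {p : K[X]} (hp : p.natDegree ≤ N c) :
    th E N ζ {c} p = ζ (E c * p) := by
  refine linext (th E N ζ {c}) (ζ ∘ₗ LinearMap.mulLeft K (E c)) (N c) ?_ p hp
  intro m hm
  rw [theta_X_pow, mon_single h.exch hm]
  rfl

theorem th_one (h : BinRel E N ζ) : th E N ζ 0 1 = 1 := by
  have := theta_X_pow (K := K) (x := (fun c i => ζ (E c * X ^ i))) (N := N) 0 0
  rw [pow_zero] at this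
  rw [th, this, mon_zero h.exch]

theorem th_pair [IsAlgClosed K] (h : BinRel E N ζ)
    (hE : ∀ c, (E c).natDegree ≤ N (!c) + 2) (c : Bool) {g : K[X]} (hg : g.natDegree + 2 ≤ N c) :
    th E N ζ ({false} + {c}) (E true * g) = th E N ζ ({true} + {c}) (E false * g) := by
  have h1 := hE true
  have h2 := hE false
  simp only [Bool.not_true, Bool.not_false] at h1 h2
  have d1 : (E true * g).natDegree ≤ N false + N c := natDegree_mul_le.trans (by omega)
  have d2 : (E false * g).natDegree ≤ N true + N c := natDegree_mul_le.trans (by omega)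
  obtain ⟨p, q, e, hp, hq⟩ := factor_split _ _ _ d1
  obtain ⟨p', q', e', hp', hq'⟩ := factor_split _ _ _ d2
  rw [e, e', th, th, theta_mul h.exch (by simpa using hp) (by simpa using hq),
    theta_mul h.exch (by simpa using hp') (by simpa using hq'),
    th_single h hp, th_single h hq, th_single h hp', th_single h hq']
  apply h _ _ _ _ _ _ _ _ hp hq hp' hq'
  calc E false * p * (E c * q) = E false * E c * (p * q) := by ring
    _ = E true * E c * (p' * q') := by rw [← e, ← e']; ring
    _ = _ := by ring

theorem th_swap [IsAlgClosed K] (h : BinRel E N ζ) (hN : ∀ c, 2 ≤ N c)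
    (hE : ∀ c, (E c).natDegree ≤ N (!c) + 2) (u : Multiset Bool) {e : K[X]}
    (he : e.natDegree + 2 ≤ (u.map N).sum) :
    th E N ζ ({false} + u) (E true * e) = th E N ζ ({true} + u) (E false * e) := by
  have hE1 := hE true
  have hE2 := hE false
  simp only [Bool.not_true, Bool.not_false] at hE1 hE2
  induction u using Multiset.induction with
  | empty => simp at he
  | cons c v _ =>
    rw [Multiset.map_cons, Multiset.sum_cons] at he
    suffices key : ∀ m ≤ e.natDegree,
        (th E N ζ ({false} + c ::ₘ v) ∘ₗ LinearMap.mulLeft K (E true)) (X ^ m) =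
        (th E N ζ ({true} + c ::ₘ v) ∘ₗ LinearMap.mulLeft K (E false)) (X ^ m) by
      have := linext _ _ e.natDegree key e le_rfl
      simpa only [LinearMap.comp_apply, LinearMap.mulLeft_apply] using this
    intro m hm
    simp only [LinearMap.comp_apply, LinearMap.mulLeft_apply]
    have hc := hN c
    obtain ⟨m₁, m₂, rfl, hm1, hm2⟩ : ∃ m₁ m₂, m = m₁ + m₂ ∧ m₁ + 2 ≤ N c ∧ m₂ ≤ (v.map N).sum :=
      ⟨min m (N c - 2), m - min m (N c - 2), by omega, by omega, by omega⟩
    have d0 : (X ^ m₁ : K[X]).natDegree + 2 ≤ N c := by rw [natDegree_X_pow]; exact hm1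
    have d1 : (E true * X ^ m₁).natDegree ≤ N false + N c := natDegree_mul_le.trans (by omega)
    have d2 : (E false * X ^ m₁).natDegree ≤ N true + N c := natDegree_mul_le.trans (by omega)
    rw [← Multiset.singleton_add, ← add_assoc, ← add_assoc, pow_add, ← mul_assoc, ← mul_assoc,
      th, th, theta_mul (s := {false} + {c}) h.exch (by simpa using d1) (by rw [natDegree_X_pow]; exact hm2),
      theta_mul (s := {true} + {c}) h.exch (by simpa using d2) (by rw [natDegree_X_pow]; exact hm2)]
    congr 1
    exact th_pair h hE c d0

/-- the multiset with `k - j` entries `true` and `j` entries `false` -/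
def ms (k j : ℕ) : Multiset Bool := Multiset.replicate (k - j) true + Multiset.replicate j false

theorem ms_bound (k j : ℕ) : ((ms k j).map N).sum = (k - j) * N true + j * N false := by
  simp [ms]

theorem core_elim [IsAlgClosed K] (h : BinRel E N ζ) (hN : ∀ c, 2 ≤ N c)
    (hE : ∀ c, (E c).natDegree ≤ N (!c) + 2) (hA : (E true).natDegree = N false + 2)
    (hcop : IsCoprime (E true) (E false)) (k : ℕ) (G : ℕ → K[X])
    (hG : ∀ j, (G j).natDegree ≤ ((ms k j).map N).sum) (J : ℕ) (hJ : J ≤ k) :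
    ∀ e : K[X], e.natDegree ≤ ((ms k J).map N).sum →
    ∑ j ∈ Finset.range J, G j * (E true ^ (k - j) * E false ^ j)
      + e * (E true ^ (k - J) * E false ^ J) = 0 →
    ∑ j ∈ Finset.range J, th E N ζ (ms k j) (G j) + th E N ζ (ms k J) e = 0 := by
  have hE0 : E true ≠ 0 := by
    intro h0
    rw [h0] at hA; simp at hA
  have hE2 := hE false
  simp only [Bool.not_false] at hE2
  induction J with
  | zero =>
    intro e _ he
    have : e = 0 := by simpa [hE0] using he
    simp [this]
  | succ J ih =>
    intro e hdeg he
    have hdvd : E true ∣ e := by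
      have h1 : E true ^ (k - J) ∣ ∑ j ∈ Finset.range (J + 1), G j * (E true ^ (k - j) * E false ^ j) := by
        refine Finset.dvd_sum fun j hj => ?_
        have := Finset.mem_range.1 hj
        exact Dvd.dvd.mul_left (Dvd.dvd.mul_right (pow_dvd_pow _ (by omega)) _) _
      have h2 : E true ^ (k - J) ∣ e * (E true ^ (k - (J + 1)) * E false ^ (J + 1)) := by
        rw [← dvd_add_right h1, he]; exact dvd_zero _
      have e1 : k - J = (k - (J + 1)) + 1 := by omega
      rw [e1, pow_succ, mul_left_comm] at h2
      have h3 := (mul_dvd_mul_iff_left (pow_ne_zero _ hE0)).1 h2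
      exact (hcop.pow_right).dvd_of_dvd_mul_right h3
    obtain ⟨g, rfl⟩ := hdvd
    -- common part
    obtain ⟨u, hu1, hu2⟩ : ∃ u, ms k (J + 1) = {false} + u ∧ ms k J = {true} + u := by
      refine ⟨Multiset.replicate (k - (J + 1)) true + Multiset.replicate J false, ?_, ?_⟩
      · rw [ms, Multiset.replicate_succ, ← Multiset.singleton_add]; abel
      · rw [ms, show k - J = (k - (J + 1)) + 1 by omega, Multiset.replicate_succ,
          ← Multiset.singleton_add]; abel
    have hsw : th E N ζ (ms k (J + 1)) (E true * g) = th E N ζ (ms k J) (E false * g) ∧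
        (E false * g).natDegree ≤ ((ms k J).map N).sum := by
      by_cases hg : g = 0
      · simp [hg]
      rw [natDegree_mul hE0 hg, hA, hu1] at hdeg
      simp only [Multiset.map_add, Multiset.map_singleton, Multiset.sum_add,
        Multiset.sum_singleton] at hdeg
      constructor
      · rw [hu1, hu2]
        exact th_swap h hN hE u (by omega)
      · rw [hu2]
        simp only [Multiset.map_add, Multiset.map_singleton, Multiset.sum_add,
          Multiset.sum_singleton]
        exact natDegree_mul_le.trans (by omega)
    have := ih (by omega) (G J + E false * g) (natDegree_add_le_of_degree_le (hG J) hsw.2) (by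
      rw [← he, Finset.sum_range_succ, show k - J = (k - (J + 1)) + 1 by omega]
      ring)
    rw [map_add] at this
    rw [← this, Finset.sum_range_succ, hsw.1]
    abel

/-- elements in normal form of degree `k`, with their image -/
def Good (E : Bool → K[X]) (N : Bool → ℕ) (ζ : K[X] →ₗ[K] M) (k : ℕ) (y : M) (r : K[X]) : Prop :=
  ∃ G : ℕ → K[X], (∀ j, (G j).natDegree ≤ ((ms k j).map N).sum) ∧
    r = ∑ j ∈ Finset.range (k + 1), G j * (E true ^ (k - j) * E false ^ j) ∧
    y = ∑ j ∈ Finset.range (k + 1), th E N ζ (ms k j) (G j)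

theorem Good.eq_zero [IsAlgClosed K] (h : BinRel E N ζ) (hN : ∀ c, 2 ≤ N c)
    (hE : ∀ c, (E c).natDegree ≤ N (!c) + 2) (hA : (E true).natDegree = N false + 2)
    (hcop : IsCoprime (E true) (E false)) {k : ℕ} {y : M} (hg : Good E N ζ k y 0) : y = 0 := by
  obtain ⟨G, hG, hr, rfl⟩ := hg
  rw [Finset.sum_range_succ] at hr ⊢
  exact core_elim h hN hE hA hcop k G hG k le_rfl (G k) (hG k) hr.symm

theorem Good.add {k : ℕ} {y y' : M} {r r' : K[X]} (h : Good E N ζ k y r)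
    (h' : Good E N ζ k y' r') : Good E N ζ k (y + y') (r + r') := by
  obtain ⟨G, hG, rfl, rfl⟩ := h
  obtain ⟨G', hG', rfl, rfl⟩ := h'
  refine ⟨fun j => G j + G' j, fun j => natDegree_add_le_of_degree_le (hG j) (hG' j), ?_, ?_⟩
  · rw [← Finset.sum_add_distrib]
    exact Finset.sum_congr rfl fun j _ => by ring
  · rw [← Finset.sum_add_distrib]
    exact Finset.sum_congr rfl fun j _ => by rw [map_add]

theorem Good.const (h : BinRel E N ζ) (a : K) :
    Good E N ζ 0 (algebraMap K M a) (C a) := by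
  refine ⟨fun _ => C a, fun j => by simp, by simp, ?_⟩
  have h0 : ms 0 0 = 0 := by simp [ms]
  have h1 : (C a : K[X]) = a • 1 := by rw [smul_eq_C_mul, mul_one]
  simp only [zero_add, Finset.range_one, Finset.sum_singleton, h0]
  rw [h1, map_smul, th_one h, Algebra.smul_def, mul_one]

theorem Good.mul_true (h : BinRel E N ζ) {k : ℕ} {y : M} {r : K[X]} (hg : Good E N ζ k y r)
    {p : K[X]} (hp : p.natDegree ≤ N true) :
    Good E N ζ (k + 1) (ζ (E true * p) * y) (E true * p * r) := by
  obtain ⟨G, hG, rfl, rfl⟩ := hg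
  have hms : ∀ j, j ≤ k → ms (k + 1) j = {true} + ms k j := by
    intro j hj
    rw [ms, ms, show k + 1 - j = (k - j) + 1 by omega, Multiset.replicate_succ,
      ← Multiset.singleton_add]; abel
  refine ⟨fun j => if j ≤ k then p * G j else 0, ?_, ?_, ?_⟩
  · intro j
    by_cases hj : j ≤ k
    · simp only [hj, if_true]
      rw [hms j hj]
      simp only [Multiset.map_add, Multiset.map_singleton, Multiset.sum_add,
          Multiset.sum_singleton]
      exact natDegree_mul_le.trans (add_le_add hp (hG j))
    · simp [hj]
  · rw [Finset.sum_range_succ _ (k + 1)]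
    simp only [Nat.not_succ_le_self, if_false, zero_mul, add_zero]
    rw [Finset.mul_sum]
    refine Finset.sum_congr rfl fun j hj => ?_
    have hj' : j ≤ k := Nat.lt_succ_iff.1 (Finset.mem_range.1 hj)
    rw [if_pos hj', show k + 1 - j = (k - j) + 1 by omega]
    ring
  · rw [Finset.sum_range_succ _ (k + 1)]
    simp only [Nat.not_succ_le_self, if_false, map_zero, add_zero]
    rw [Finset.mul_sum]
    refine Finset.sum_congr rfl fun j hj => ?_
    have hj' : j ≤ k := Nat.lt_succ_iff.1 (Finset.mem_range.1 hj)
    rw [if_pos hj', hms j hj', th, theta_mul h.exch (by simpa using hp) (hG j), th_single h hp]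

theorem Good.mul_false (h : BinRel E N ζ) {k : ℕ} {y : M} {r : K[X]} (hg : Good E N ζ k y r)
    {p : K[X]} (hp : p.natDegree ≤ N false) :
    Good E N ζ (k + 1) (ζ (E false * p) * y) (E false * p * r) := by
  obtain ⟨G, hG, rfl, rfl⟩ := hg
  have hms : ∀ j, ms (k + 1) (j + 1) = {false} + ms k j := by
    intro j
    rw [ms, ms, show k + 1 - (j + 1) = k - j by omega, Multiset.replicate_succ,
      ← Multiset.singleton_add]; abel
  refine ⟨fun j => if j = 0 then 0 else p * G (j - 1), ?_, ?_, ?_⟩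
  · intro j
    rcases j with _ | j
    · simp
    · simp only [Nat.succ_ne_zero, if_false, Nat.add_sub_cancel]
      rw [hms j]
      simp only [Multiset.map_add, Multiset.map_singleton, Multiset.sum_add,
          Multiset.sum_singleton]
      exact natDegree_mul_le.trans (add_le_add hp (hG j))
  · rw [Finset.sum_range_succ' _ (k + 1)]
    simp only [Nat.succ_ne_zero, if_false, if_true, zero_mul, add_zero, Nat.add_sub_cancel]
    rw [Finset.mul_sum]
    refine Finset.sum_congr rfl fun j hj => ?_
    rw [show k + 1 - (j + 1) = k - j by omega]
    ring
  · rw [Finset.sum_range_succ' _ (k + 1)]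
    simp only [Nat.succ_ne_zero, if_false, if_true, map_zero, add_zero, Nat.add_sub_cancel]
    rw [Finset.mul_sum]
    refine Finset.sum_congr rfl fun j hj => ?_
    rw [hms j, th, theta_mul h.exch (by simpa using hp) (hG j), th_single h hp]

end Core

end PartB

section PartC
open Polynomial

section Apolar
variable {K : Type*} [Field K]

theorem exists_ker (n r : ℕ) (hr : r ≤ n) (ψ : Fin r → K[X] →ₗ[K] K) :
    ∃ p : K[X], p ≠ 0 ∧ p.natDegree ≤ n ∧ ∀ i, ψ i p = 0 := by
  let L : (degreeLT K (n + 1)) →ₗ[K] (Fin r → K) :=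
    (LinearMap.pi ψ) ∘ₗ (degreeLT K (n + 1)).subtype
  have : Module.Finite K (degreeLT K (n + 1)) :=
    Module.Finite.equiv (degreeLTEquiv K (n + 1)).symm
  have hlt : Module.finrank K (Fin r → K) < Module.finrank K (degreeLT K (n + 1)) := by
    rw [(degreeLTEquiv K (n + 1)).finrank_eq]
    simp; omega
  have hk := LinearMap.ker_ne_bot_of_finrank_lt (f := L) hlt
  obtain ⟨v, hv, hv0⟩ := Submodule.exists_mem_ne_zero_of_ne_bot hk
  refine ⟨v.1, fun h => hv0 (Subtype.ext h), ?_, ?_⟩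
  · have := mem_degreeLT.1 v.2
    by_cases h0 : v.1 = 0
    · simp [h0]
    · have := (natDegree_lt_iff_degree_lt h0).2 this
      omega
  · intro i
    exact congrFun (LinearMap.mem_ker.1 hv) i

theorem bez {P Q : K[X]} (hcop : IsCoprime P Q) {m n : ℕ} (hP : P.natDegree = m) (hP0 : P ≠ 0)
    (hQ : Q.natDegree ≤ n) (hmn : 1 ≤ m) {L : ℕ} (hL : m + n ≤ L + 1) (r : K[X])
    (hr : r.natDegree ≤ L) : ∃ u v : K[X], r = P * u + Q * v ∧ u.natDegree + m ≤ max L m ∧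
      v.natDegree + 1 ≤ m := by
  obtain ⟨x, y, hxy⟩ := hcop
  have hdm := EuclideanDomain.div_add_mod (r * y) P
  set v := (r * y) % P with hv
  have hvd : v.natDegree < m := by
    rw [← hP]; exact natDegree_mod_lt _ (by omega)
  have e : r = P * (r * x + Q * ((r * y) / P)) + Q * v := by
    calc r = r * (x * P + y * Q) := by rw [hxy, mul_one]
      _ = r * x * P + Q * (r * y) := by ring
      _ = r * x * P + Q * (P * ((r * y) / P) + v) := by rw [hdm]
      _ = _ := by ring
  refine ⟨_, v, e, ?_, by omega⟩
  set u := r * x + Q * ((r * y) / P)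
  by_cases hu : u = 0
  · simp [hu]
  have h1 : (P * u).natDegree ≤ L := by
    have : P * u = r - Q * v := by rw [e]; ring
    rw [this]
    refine (natDegree_sub_le _ _).trans (max_le hr (natDegree_mul_le.trans (by omega)))
  rw [natDegree_mul hP0 hu] at h1
  omega

/-- If two coprime multiples of a polynomial kill the functional, so does the polynomial. -/
theorem kill_gcd (lam : K[X] →ₗ[K] K) {d a b c : ℕ} {g P Q : K[X]} (hcop : IsCoprime P Q)
    (hab : a + b = d + 2) (hb2 : 2 ≤ b) (hc : 1 ≤ c) (hca : c < a) (hcb : c ≤ b) (hP : P.natDegree + c = a) (hP0 : P ≠ 0)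
    (hQ : Q.natDegree + c ≤ b)
    (h1 : ∀ p : K[X], p.natDegree + a ≤ d → lam (g * P * p) = 0)
    (h2 : ∀ p : K[X], p.natDegree + b ≤ d → lam (g * Q * p) = 0)
    (r : K[X]) (hr : r.natDegree + c ≤ d) : lam (g * r) = 0 := by
  obtain ⟨u, v, e, hu, hv⟩ := bez hcop (m := a - c) (n := b - c) (by omega) hP0 (by omega) (by omega)
    (L := d - c) (by omega) r (by omega)
  rw [e, mul_add, map_add, ← mul_assoc, ← mul_assoc, h1 u (by omega), h2 v (by omega), add_zero]

theorem exists_red (A B : K[X]) (hA0 : A ≠ 0) :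
    ∃ g P Q : K[X], IsCoprime P Q ∧ g * P = A ∧ g * Q = B := by
  classical
  obtain ⟨P, hP⟩ := EuclideanDomain.gcd_dvd_left A B
  obtain ⟨Q, hQ⟩ := EuclideanDomain.gcd_dvd_right A B
  have hb := EuclideanDomain.gcd_eq_gcd_ab A B
  generalize EuclideanDomain.gcd A B = g at *
  generalize EuclideanDomain.gcdA A B = x at *
  generalize EuclideanDomain.gcdB A B = y at *
  have hg0 : g ≠ 0 := by rintro rfl; exact hA0 (by rw [hP, zero_mul])
  refine ⟨g, P, Q, ⟨x, y, mul_left_cancel₀ hg0 ?_⟩, hP.symm, hQ.symm⟩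
  calc g * (x * P + y * Q) = (g * P) * x + (g * Q) * y := by ring
    _ = g * 1 := by rw [← hP, ← hQ, mul_one]; exact hb.symm

/-- Structure of the annihilator. -/
theorem exists_AB (d : ℕ) (lam : K[X] →ₗ[K] K)
    (hlam : ∀ G : K[X], G.natDegree ≤ 3 → (∀ p : K[X], p.natDegree + 3 ≤ d → lam (G * p) = 0) →
      G = 0) :
    ∃ (a b : ℕ) (A B : K[X]), a + b = d + 2 ∧ 4 ≤ a ∧ 4 ≤ b ∧ A.natDegree = a ∧ B.natDegree ≤ b ∧
      IsCoprime A B ∧ (∀ p : K[X], p.natDegree + a ≤ d → lam (A * p) = 0) ∧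
      (∀ p : K[X], p.natDegree + b ≤ d → lam (B * p) = 0) := by
  classical
  -- annihilating linear conditions
  have hann : ∀ (c n : ℕ) (G : K[X]), n + c = d + 1 → (∀ i : Fin n, lam (G * X ^ (i : ℕ)) = 0) →
      ∀ p : K[X], p.natDegree + c ≤ d → lam (G * p) = 0 := by
    intro c n G hn hG p hp
    refine linext (lam ∘ₗ LinearMap.mulLeft K G) 0 p.natDegree ?_ p le_rfl
    intro m hm
    exact hG ⟨m, by omega⟩
  let Pr : ℕ → Prop := fun a => ∃ A : K[X], A ≠ 0 ∧ A.natDegree ≤ a ∧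
    ∀ p : K[X], p.natDegree + a ≤ d → lam (A * p) = 0
  have hex : Pr (d / 2 + 1) := by
    obtain ⟨A, hA0, hAd, hA⟩ := exists_ker (d / 2 + 1) (d - d / 2) (by omega)
      (fun i => lam ∘ₗ LinearMap.mulRight K (X ^ (i : ℕ)))
    exact ⟨A, hA0, hAd, hann _ _ A (by omega) hA⟩
  have hPex : ∃ a, Pr a := ⟨_, hex⟩
  set a := Nat.find hPex with ha
  have hmin : ∀ c, c < a → ¬ Pr c := fun c hc => Nat.find_min hPex hc
  have hale : a ≤ d / 2 + 1 := Nat.find_min' hPex hex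
  obtain ⟨A, hA0, hAd, hA⟩ : Pr a := Nat.find_spec hPex
  have ha4 : 4 ≤ a := by
    by_contra hlt
    exact hA0 (hlam A (by omega) fun p hp => hA p (by omega))
  obtain ⟨b, hab⟩ : ∃ b, a + b = d + 2 := ⟨d + 2 - a, by omega⟩
  have hle : a ≤ b := by omega
  obtain ⟨B, hB0, hBd, hB⟩ := exists_ker b ((a - 1) + (b - a + 1)) (by omega)
    (Fin.append (fun i : Fin (a - 1) => lam ∘ₗ LinearMap.mulRight K (X ^ (i : ℕ)))
      (fun i : Fin (b - a + 1) => lcoeff K (A.natDegree + i)))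
  have hB1 : ∀ i : Fin (a - 1), lam (B * X ^ (i : ℕ)) = 0 := by
    intro i
    have := hB (Fin.castAdd _ i)
    rwa [Fin.append_left] at this
  have hB2 : ∀ i, i ≤ b - a → B.coeff (A.natDegree + i) = 0 := by
    intro i hi
    have := hB (Fin.natAdd _ ⟨i, by omega⟩)
    rwa [Fin.append_right] at this
  have hBann := hann b (a - 1) B (by omega) hB1
  -- not a multiple
  have hnm : ∀ g : K[X], B = A * g → b - a < g.natDegree := by
    intro g hg
    by_contra hlt
    have h0 := hB2 g.natDegree (by omega)
    rw [hg, coeff_mul_degree_add_degree] at h0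
    rcases mul_eq_zero.1 h0 with h | h
    · exact hA0 (leadingCoeff_eq_zero.1 h)
    · rw [leadingCoeff_eq_zero.1 h, mul_zero] at hg
      exact hB0 hg
  -- gcd
  obtain ⟨g, P, Q, hPQ, hgP, hgQ⟩ : ∃ g P Q : K[X], IsCoprime P Q ∧ g * P = A ∧ g * Q = B := exists_red A B hA0
  have hg0 : g ≠ 0 := by rintro rfl; simp at hgP; exact hA0 hgP.symm
  have hP0 : P ≠ 0 := by rintro rfl; simp at hgP; exact hA0 hgP.symm
  have hQ0 : Q ≠ 0 := by rintro rfl; simp at hgQ; exact hB0 hgQ.symm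
  have dA : A.natDegree = g.natDegree + P.natDegree := by rw [← hgP, natDegree_mul hg0 hP0]
  have dB : B.natDegree = g.natDegree + Q.natDegree := by rw [← hgQ, natDegree_mul hg0 hQ0]
  -- total common degree
  obtain ⟨c, hcdef⟩ : ∃ c, c = g.natDegree + min (a - A.natDegree) (b - B.natDegree) := ⟨_, rfl⟩
  have hca : c < a := by
    by_contra hcon
    have hPd : P.natDegree = 0 := by omega
    obtain ⟨κ, hκ⟩ := natDegree_eq_zero.1 hPd
    have hκ0 : κ ≠ 0 := by rintro rfl; simp at hκ; exact hP0 hκ.symm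
    have e : B = A * (C κ⁻¹ * Q) := by
      rw [← hgP, ← hgQ, ← hκ]
      calc g * Q = g * (C (κ * κ⁻¹)) * Q := by rw [mul_inv_cancel₀ hκ0]; simp
        _ = _ := by rw [C_mul]; ring
    have := hnm _ e
    rw [natDegree_C_mul (inv_ne_zero hκ0)] at this
    omega
  have hc0 : c = 0 := by
    by_contra hc
    refine hmin c hca ⟨g, hg0, by omega, ?_⟩
    subst hgP hgQ
    rcases le_total (a - (g * P).natDegree) (b - (g * Q).natDegree) with hle' | hle'
    · exact kill_gcd lam hPQ hab (by omega) (by omega) hca (by omega) (by omega) hP0 (by omega) hA hBann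
    · exact kill_gcd lam hPQ.symm (by omega : b + a = d + 2) (by omega) (by omega) (by omega) (by omega)
        (by omega) hQ0 (by omega) hBann hA
  have hcop : IsCoprime A B := by
    have hu : IsUnit g := by
      rw [isUnit_iff_degree_eq_zero, degree_eq_natDegree hg0]
      have : g.natDegree = 0 := by omega
      simp [this]
    rw [← hgP, ← hgQ]
    exact (isCoprime_mul_unit_left hu P Q).2 hPQ
  by_cases hAa : A.natDegree = a
  · exact ⟨a, b, A, B, hab, ha4, by omega, hAa, hBd, hcop, hA, hBann⟩
  · exact ⟨b, a, B, A, by omega, by omega, ha4, by omega, hAd, hcop.symm, hBann, hA⟩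

/-- Every element of the hyperplane is `A p + B q`. -/
theorem hyper_decomp {d : ℕ} {lam : K[X] →ₗ[K] K} {a b : ℕ} {A B : K[X]} (hab : a + b = d + 2)
    (ha : 4 ≤ a) (hb : 4 ≤ b) (hAd : A.natDegree = a) (hBd : B.natDegree ≤ b)
    (hcop : IsCoprime A B) (hA : ∀ p : K[X], p.natDegree + a ≤ d → lam (A * p) = 0)
    (hB : ∀ p : K[X], p.natDegree + b ≤ d → lam (B * p) = 0)
    (hne : ∃ r₀ : K[X], r₀.natDegree ≤ d ∧ lam r₀ ≠ 0)
    (r : K[X]) (hr : r.natDegree ≤ d) (hlr : lam r = 0) :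
    ∃ p q : K[X], r = A * p + B * q ∧ p.natDegree ≤ b - 2 ∧ q.natDegree ≤ a - 2 := by
  have hA0 : A ≠ 0 := by rintro rfl; simp at hAd; omega
  have key : ∀ u v r : K[X], r.natDegree ≤ d → r = A * u + B * v → v.natDegree ≤ a - 2 →
      u.natDegree ≤ b - 2 := by
    intro u v r hr e hv
    by_cases hu : u = 0
    · simp [hu]
    have h1 : (A * u).natDegree ≤ d := by
      have : A * u = r - B * v := by rw [e]; ring
      rw [this]
      exact (natDegree_sub_le _ _).trans (max_le hr (natDegree_mul_le.trans (by omega)))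
    rw [natDegree_mul hA0 hu] at h1
    omega
  have red : ∀ v : K[X], v.natDegree + 1 ≤ a → v.coeff (a - 1) = 0 → v.natDegree ≤ a - 2 := by
    intro v hv hc
    by_contra hcon
    have : v.natDegree = a - 1 := by omega
    rw [← this, coeff_natDegree, leadingCoeff_eq_zero] at hc
    rw [hc] at hcon; simp at hcon
  obtain ⟨r₀, hr₀, hl₀⟩ := hne
  obtain ⟨u₀, v₀, e₀, -, hv₀⟩ := bez hcop hAd hA0 hBd (by omega) (L := d + 1) (by omega) r₀ (by omega)
  obtain ⟨u, v, e, -, hv⟩ := bez hcop hAd hA0 hBd (by omega) (L := d + 1) (by omega) r (by omega)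
  have van : ∀ u v r : K[X], r.natDegree ≤ d → r = A * u + B * v → v.natDegree ≤ a - 2 →
      lam r = 0 := by
    intro u v r hr e hv
    have := key u v r hr e hv
    rw [e, map_add, hA u (by omega), hB v (by omega), add_zero]
  have hκ₀ : v₀.coeff (a - 1) ≠ 0 := fun h => hl₀ (van u₀ v₀ r₀ hr₀ e₀ (red v₀ hv₀ h))
  set κ := v.coeff (a - 1) / v₀.coeff (a - 1) with hκ
  have h3 : lam (r - C κ * r₀) = 0 := by
    apply van (u - C κ * u₀) (v - C κ * v₀) _ ((natDegree_sub_le _ _).trans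
      (max_le hr ((natDegree_C_mul_le _ _).trans hr₀)))
    · rw [e, e₀]; ring
    · apply red
      · have := (natDegree_sub_le v (C κ * v₀)).trans
          (max_le (by omega : v.natDegree ≤ a - 1) ((natDegree_C_mul_le _ _).trans (by omega)))
        omega
      · rw [coeff_sub, coeff_C_mul, hκ, div_mul_cancel₀ _ hκ₀, sub_self]
  rw [map_sub, hlr, zero_sub, neg_eq_zero, ← smul_eq_C_mul, map_smul, smul_eq_mul, mul_eq_zero] at h3
  have hκ0 : κ = 0 := h3.resolve_right hl₀
  have hc0 : v.coeff (a - 1) = 0 := by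
    rcases div_eq_zero_iff.1 hκ0 with h | h
    · exact h
    · exact absurd h hκ₀
  have hv2 := red v hv hc0
  exact ⟨u, v, e, key u v r hr e hv2, hv2⟩

end Apolar

end PartC

open MvPolynomial

section Bridge
variable {K : Type*} [Field K]

/-- exponent vector -/
noncomputable def ex (i j : ℕ) : Fin 2 →₀ ℕ := Finsupp.single 0 i + Finsupp.single 1 j

@[simp] theorem ex_zero (i j : ℕ) : ex i j 0 = i := by simp [ex]
@[simp] theorem ex_one (i j : ℕ) : ex i j 1 = j := by simp [ex]

theorem eq_ex {a : Fin 2 →₀ ℕ} {i j : ℕ} (h0 : a 0 = i) (h1 : a 1 = j) : a = ex i j := by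
  ext t
  fin_cases t
  · simpa using h0
  · simpa using h1

theorem degree_two (a : Fin 2 →₀ ℕ) : a.degree = a 0 + a 1 := by
  rw [Finsupp.degree_eq_sum, Fin.sum_univ_two]

theorem hom_deg {G : MvPolynomial (Fin 2) K} {n : ℕ} (hG : G.IsHomogeneous n) {a : Fin 2 →₀ ℕ}
    (ha : a ∈ G.support) : a 0 + a 1 = n := by
  rw [← degree_two]
  by_contra hne
  exact (mem_support_iff.1 ha) (hG.coeff_eq_zero hne)

/-- dehomogenization -/
noncomputable def deh : MvPolynomial (Fin 2) K →ₐ[K] Polynomial K :=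
  aeval ![1, Polynomial.X]

theorem deh_monomial (a : Fin 2 →₀ ℕ) (c : K) :
    deh (monomial a c) = Polynomial.monomial (a 1) c := by
  rw [deh, aeval_monomial, Finsupp.prod_fintype _ _ (by simp), Fin.prod_univ_two]
  simp [← Polynomial.C_mul_X_pow_eq_monomial]

theorem deh_eq (G : MvPolynomial (Fin 2) K) :
    deh G = ∑ a ∈ G.support, Polynomial.monomial (a 1) (G.coeff a) := by
  conv_lhs => rw [G.as_sum]
  rw [map_sum]
  exact Finset.sum_congr rfl fun a _ => deh_monomial a _

theorem deh_natDegree {G : MvPolynomial (Fin 2) K} {n : ℕ} (hG : G.IsHomogeneous n) :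
    (deh G).natDegree ≤ n := by
  rw [deh_eq]
  refine Polynomial.natDegree_sum_le_of_forall_le _ _ fun a ha => ?_
  refine (Polynomial.natDegree_monomial_le _).trans ?_
  have := hom_deg hG ha
  omega

/-- homogenization -/
noncomputable def homog (n : ℕ) : Polynomial K →ₗ[K] MvPolynomial (Fin 2) K :=
  ∑ i ∈ Finset.range (n + 1), (monomial (ex (n - i) i)) ∘ₗ (Polynomial.lcoeff K i)

theorem homog_apply (n : ℕ) (p : Polynomial K) :
    homog n p = ∑ i ∈ Finset.range (n + 1), monomial (ex (n - i) i) (p.coeff i) := by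
  simp [homog]

theorem homog_isHomogeneous (n : ℕ) (p : Polynomial K) : (homog n p).IsHomogeneous n := by
  rw [homog_apply]
  refine IsHomogeneous.sum _ _ _ fun i hi => isHomogeneous_monomial _ ?_
  have := Finset.mem_range.1 hi
  rw [degree_two, ex_zero, ex_one]
  omega

theorem deh_homog {n : ℕ} {p : Polynomial K} (hp : p.natDegree ≤ n) : deh (homog n p) = p := by
  rw [homog_apply, map_sum]
  conv_rhs => rw [p.as_sum_range' (n + 1) (by omega)]
  refine Finset.sum_congr rfl fun i _ => ?_
  rw [deh_monomial, ex_one]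

theorem homog_deh {n : ℕ} {G : MvPolynomial (Fin 2) K} (hG : G.IsHomogeneous n) :
    homog n (deh G) = G := by
  rw [deh_eq, map_sum]
  conv_rhs => rw [G.as_sum]
  refine Finset.sum_congr rfl fun a ha => ?_
  have := hom_deg hG ha
  rw [homog_apply, Finset.sum_eq_single (a 1)]
  · rw [Polynomial.coeff_monomial_same, ← eq_ex (a := a) (by omega) rfl]
  · intro i _ hi
    rw [Polynomial.coeff_monomial_of_ne _ hi, monomial_zero]
  · intro h
    exact absurd (Finset.mem_range.2 (by omega)) h

theorem deh_inj {n : ℕ} {G : MvPolynomial (Fin 2) K} (hG : G.IsHomogeneous n) (h : deh G = 0) :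
    G = 0 := by
  rw [← homog_deh hG, h, map_zero]

theorem coeff_iter (i : Fin 2) (k : ℕ) : ∀ (f : MvPolynomial (Fin 2) K) (b : Fin 2 →₀ ℕ),
    coeff b ((⇑(pderiv i))^[k] f) * ((b i).factorial : K) =
      coeff (b + Finsupp.single i k) f * ((b i + k).factorial : K) := by
  induction k with
  | zero => intro f b; simp
  | succ k ih =>
    intro f b
    rw [Function.iterate_succ_apply, ih, coeff_pderiv, add_assoc, ← Finsupp.single_add,
      show b i + (k + 1) = (b i + k) + 1 by omega, Nat.factorial_succ]
    simp
    ring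

theorem coeff_iter2 (f : MvPolynomial (Fin 2) K) (a b : Fin 2 →₀ ℕ) :
    coeff b ((⇑(pderiv (0 : Fin 2)))^[a 0] ((⇑(pderiv (1 : Fin 2)))^[a 1] f)) *
      (((b 0).factorial : K) * ((b 1).factorial : K)) =
      coeff (a + b) f * (((a 0 + b 0).factorial : K) * ((a 1 + b 1).factorial : K)) := by
  have h1 := coeff_iter (0 : Fin 2) (a 0) ((⇑(pderiv (1 : Fin 2)))^[a 1] f) b
  have h2 := coeff_iter (1 : Fin 2) (a 1) f (b + Finsupp.single 0 (a 0))
  have e : b + Finsupp.single 0 (a 0) + Finsupp.single 1 (a 1) = a + b := by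
    ext t; fin_cases t <;> simp [add_comm]
  rw [e] at h2
  have e1 : (b + Finsupp.single (0 : Fin 2) (a 0) : Fin 2 →₀ ℕ) 1 = b 1 := by simp
  rw [e1] at h2
  rw [← mul_assoc, h1, mul_right_comm, h2, add_comm (a 0), add_comm (a 1)]
  ring

/-- the functional attached to `f` -/
noncomputable def lamf (d : ℕ) (f : MvPolynomial (Fin 2) K) : Polynomial K →ₗ[K] K :=
  ∑ i ∈ Finset.range (d + 1), (((d - i).factorial : K) * (i.factorial : K) * coeff (ex (d - i) i) f) •
    (Polynomial.lcoeff K i)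

theorem lamf_monomial {d : ℕ} (f : MvPolynomial (Fin 2) K) {i : ℕ} (hi : i ≤ d) (c : K) :
    lamf d f (Polynomial.monomial i c) =
      ((d - i).factorial : K) * (i.factorial : K) * coeff (ex (d - i) i) f * c := by
  simp only [lamf, LinearMap.sum_apply, LinearMap.smul_apply, Polynomial.lcoeff_apply, smul_eq_mul]
  rw [Finset.sum_eq_single i]
  · rw [Polynomial.coeff_monomial_same]
  · intro j _ hj
    rw [Polynomial.coeff_monomial_of_ne _ hj, mul_zero]
  · intro h
    exact absurd (Finset.mem_range.2 (by omega)) h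

theorem lamf_apolar {d n j : ℕ} (f : MvPolynomial (Fin 2) K) {G : MvPolynomial (Fin 2) K}
    (hG : G.IsHomogeneous n) (hj : j + n ≤ d) :
    lamf d f (deh G * Polynomial.X ^ j) = coeff (ex (d - n - j) j) (apolar G f) *
      (((d - n - j).factorial : K) * (j.factorial : K)) := by
  rw [deh_eq, Finset.sum_mul, map_sum, apolar, coeff_sum, Finset.sum_mul]
  refine Finset.sum_congr rfl fun a ha => ?_
  have hdeg := hom_deg hG ha
  have h := coeff_iter2 f a (ex (d - n - j) j)
  rw [ex_zero, ex_one] at h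
  rw [coeff_smul, smul_eq_mul, mul_assoc, h, Polynomial.monomial_mul_X_pow,
    lamf_monomial f (by omega)]
  have e : a + ex (d - n - j) j = ex (d - (a 1 + j)) (a 1 + j) := by
    apply eq_ex
    · simp; omega
    · simp
  rw [e, show a 0 + (d - n - j) = d - (a 1 + j) by omega]
  ring

theorem apolar_eq_zero [CharZero K] {d n : ℕ} {f : MvPolynomial (Fin 2) K} (hf : f.IsHomogeneous d)
    {G : MvPolynomial (Fin 2) K} (hG : G.IsHomogeneous n)
    (h : ∀ j, j + n ≤ d → lamf d f (deh G * Polynomial.X ^ j) = 0) : apolar G f = 0 := by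
  ext b
  rw [coeff_zero]
  have hfac : ∀ m : ℕ, (m.factorial : K) ≠ 0 := fun m => Nat.cast_ne_zero.2 (Nat.factorial_ne_zero m)
  by_cases hb : b 0 + b 1 + n = d
  · have h1 := h (b 1) (by omega)
    rw [lamf_apolar f hG (by omega), ← eq_ex (a := b) (by omega) rfl] at h1
    exact (mul_eq_zero.1 h1).resolve_right (mul_ne_zero (hfac _) (hfac _))
  · rw [apolar, coeff_sum]
    refine Finset.sum_eq_zero fun a ha => ?_
    have hdeg := hom_deg hG ha
    have h2 := coeff_iter2 f a b
    rw [hf.coeff_eq_zero (d := a + b) (by rw [degree_two]; simp; omega), zero_mul] at h2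
    rw [coeff_smul, (mul_eq_zero.1 h2).resolve_right (mul_ne_zero (hfac _) (hfac _)), smul_zero]

theorem rankLE_binomial [IsAlgClosed K] [CharZero K] {σ : Type*} {x y z w : MvPolynomial σ K}
    (hx : x.IsHomogeneous 1) (hy : y.IsHomogeneous 1) (hz : z.IsHomogeneous 1)
    (hw : w.IsHomogeneous 1) : rankLE 4 (x * y - z * w) := by
  obtain ⟨I, hI⟩ := IsAlgClosed.exists_pow_nat_eq (-1 : K) (n := 2) (by norm_num)
  refine ⟨![C (1 / 2) * (x + y), C (I / 2) * (x - y), C (I / 2) * (z + w), C (1 / 2) * (z - w)],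
    ?_, ?_⟩
  · intro i
    fin_cases i
    · exact (hx.add hy).C_mul _
    · exact (hx.sub hy).C_mul _
    · exact (hz.add hw).C_mul _
    · exact (hz.sub hw).C_mul _
  · have e1 : (C (1 / 2) : MvPolynomial σ K) ^ 2 = C (1 / 4) := by
      rw [← C_pow]; congr 1; norm_num
    have e2 : (C (I / 2) : MvPolynomial σ K) ^ 2 = - C (1 / 4) := by
      rw [← C_pow, div_pow, hI, ← C_neg]; congr 1; norm_num
    have e3 : (C (1 / 4) : MvPolynomial σ K) * 4 = 1 := by
      rw [show (4 : MvPolynomial σ K) = C 4 from (map_ofNat C 4).symm, ← C_mul]; norm_num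
    simp only [Fin.sum_univ_four, Matrix.cons_val, mul_pow, e1, e2]
    linear_combination (z * w - x * y) * e3

end Bridge

theorem stmt3 {K : Type*} [Field K] [IsAlgClosed K] [CharZero K]
    (d : ℕ) (f : MvPolynomial (Fin 2) K) (hf : f ≠ 0) (hfd : f.IsHomogeneous d)
    (hrank : ∀ G : MvPolynomial (Fin 2) K, G.IsHomogeneous 3 → apolar G f = 0 → G = 0)
    (h : Fin d → MvPolynomial (Fin 2) K) (hind : LinearIndependent K h)
    (hspan : (Submodule.span K (Set.range h) : Set (MvPolynomial (Fin 2) K))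
      = {G | G.IsHomogeneous d ∧ apolar G f = 0}) :
    RingHom.ker (aeval h : MvPolynomial (Fin d) K →ₐ[K] MvPolynomial (Fin 2) K)
      = Ideal.span {q : MvPolynomial (Fin d) K |
          q ∈ RingHom.ker (aeval h : MvPolynomial (Fin d) K →ₐ[K] MvPolynomial (Fin 2) K)
          ∧ q.IsHomogeneous 2 ∧ rankLE 4 q} := by
  set J := Ideal.span {q : MvPolynomial (Fin d) K |
          q ∈ RingHom.ker (aeval h : MvPolynomial (Fin d) K →ₐ[K] MvPolynomial (Fin 2) K)
          ∧ q.IsHomogeneous 2 ∧ rankLE 4 q} with hJ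
  refine le_antisymm ?_ (Ideal.span_le.2 fun q hq => hq.1)
  have hmem : ∀ G, G ∈ Submodule.span K (Set.range h) ↔ G.IsHomogeneous d ∧ apolar G f = 0 := by
    intro G
    rw [← SetLike.mem_coe, hspan]; rfl
  have hhom : ∀ i, (h i).IsHomogeneous d := fun i =>
    ((hmem _).1 (Submodule.subset_span ⟨i, rfl⟩)).1
  -- the functional
  set lam := lamf d f with hlamdef
  have hlam : ∀ G : Polynomial K, G.natDegree ≤ 3 →
      (∀ p : Polynomial K, p.natDegree + 3 ≤ d → lam (G * p) = 0) → G = 0 := by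
    intro G hG hp
    have h0 := hrank (homog 3 G) (homog_isHomogeneous 3 G)
      (apolar_eq_zero hfd (homog_isHomogeneous 3 G) fun j hj => by
        rw [deh_homog hG]
        exact hp _ (by rw [Polynomial.natDegree_X_pow]; exact hj))
    rw [← deh_homog hG, h0, map_zero]
  have hne : ∃ r₀ : Polynomial K, r₀.natDegree ≤ d ∧ lam r₀ ≠ 0 := by
    by_contra hcon
    push Not at hcon
    refine one_ne_zero (hlam 1 (by simp) fun p hp => ?_)
    rw [one_mul]
    exact hcon p (by omega)
  have hW1 : ∀ G ∈ Submodule.span K (Set.range h), lam (deh G) = 0 := by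
    intro G hG
    obtain ⟨h1, h2⟩ := (hmem G).1 hG
    have := lamf_apolar (d := d) (n := d) f h1 (j := 0) (by omega)
    rw [pow_zero, mul_one, h2, coeff_zero, zero_mul] at this
    exact this
  have hW2 : ∀ p : Polynomial K, p.natDegree ≤ d → lam p = 0 →
      homog d p ∈ Submodule.span K (Set.range h) := by
    intro p hp hl
    refine (hmem _).2 ⟨homog_isHomogeneous d p, apolar_eq_zero hfd (homog_isHomogeneous d p) ?_⟩
    intro j hj
    have : j = 0 := by omega
    subst this
    rw [pow_zero, mul_one, deh_homog hp, hl]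
  -- structure
  obtain ⟨a, b, A, B, hab, ha, hb, hAd, hBd, hcop, hA, hB⟩ := exists_AB d lam hlam
  -- the section
  obtain ⟨ζ₀, hζ₀⟩ : ∃ ζ₀ : MvPolynomial (Fin 2) K →ₗ[K] MvPolynomial (Fin d) K,
      ∀ i, ζ₀ (h i) = X i := by
    obtain ⟨g, hg⟩ := LinearMap.exists_extend
      ((Module.Basis.span hind).constr K (X : Fin d → MvPolynomial (Fin d) K))
    refine ⟨g, fun i => ?_⟩
    have h1 := congrArg (fun φ => φ (Module.Basis.span hind i)) hg
    simp only [LinearMap.comp_apply, Submodule.subtype_apply] at h1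
    rw [Module.Basis.constr_basis, Module.Basis.span_apply] at h1
    exact h1
  have hζhom : ∀ G ∈ Submodule.span K (Set.range h), (ζ₀ G).IsHomogeneous 1 := by
    intro G hG
    induction hG using Submodule.span_induction with
    | mem x hx => obtain ⟨i, rfl⟩ := hx; rw [hζ₀]; exact isHomogeneous_X _ _
    | zero => rw [map_zero]; exact isHomogeneous_zero _ _ _
    | add x y _ _ hx hy => rw [map_add]; exact hx.add hy
    | smul c x _ hx => rw [map_smul, smul_eq_C_mul]; exact hx.C_mul _
  have hζsec : ∀ G ∈ Submodule.span K (Set.range h), aeval h (ζ₀ G) = G := by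
    intro G hG
    induction hG using Submodule.span_induction with
    | mem x hx => obtain ⟨i, rfl⟩ := hx; rw [hζ₀, aeval_X]
    | zero => rw [map_zero, map_zero]
    | add x y _ _ hx hy => rw [map_add, map_add, hx, hy]
    | smul c x _ hx => rw [map_smul, map_smul, hx]
  have hζret : ∀ m : MvPolynomial (Fin d) K, m.IsHomogeneous 1 →
      aeval h m ∈ Submodule.span K (Set.range h) ∧ ζ₀ (aeval h m) = m := by
    intro m hm
    have hm' : m ∈ Submodule.span K (Set.range (X : Fin d → MvPolynomial (Fin d) K)) := by
      rw [← homogeneousSubmodule_one_eq_span_X]; exact hm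
    clear hm
    induction hm' using Submodule.span_induction with
    | mem x hx =>
      obtain ⟨i, rfl⟩ := hx
      rw [aeval_X]
      exact ⟨Submodule.subset_span ⟨i, rfl⟩, hζ₀ i⟩
    | zero => rw [map_zero, map_zero]; exact ⟨zero_mem _, rfl⟩
    | add x y _ _ hx hy =>
      rw [map_add, map_add, hx.2, hy.2]; exact ⟨add_mem hx.1 hy.1, rfl⟩
    | smul c x _ hx =>
      rw [map_smul, map_smul, hx.2]; exact ⟨Submodule.smul_mem _ _ hx.1, rfl⟩
  let E : Bool → Polynomial K := fun c => if c then A else B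
  let N : Bool → ℕ := fun c => if c then b - 2 else a - 2
  let ζ : Polynomial K →ₗ[K] (MvPolynomial (Fin d) K ⧸ J) :=
    (Ideal.Quotient.mkₐ K J).toLinearMap ∘ₗ ζ₀ ∘ₗ homog d
  have hζ : ∀ p, ζ p = Ideal.Quotient.mk J (ζ₀ (homog d p)) := fun p => rfl
  have hEW : ∀ c (p : Polynomial K), p.natDegree ≤ N c →
      (E c * p).natDegree ≤ d ∧ homog d (E c * p) ∈ Submodule.span K (Set.range h) := by
    intro c p hp
    have h1 : (E c * p).natDegree ≤ d := by
      refine Polynomial.natDegree_mul_le.trans ?_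
      cases c <;> simp [E, N] at hp ⊢ <;> omega
    refine ⟨h1, hW2 _ h1 ?_⟩
    cases c
    · simp [N] at hp
      exact hB p (by omega)
    · simp [N] at hp
      exact hA p (by omega)
  have hbin : BinRel E N ζ := by
    intro c₁ c₂ c₃ c₄ p₁ p₂ p₃ p₄ h₁ h₂ h₃ h₄ e
    obtain ⟨d₁, m₁⟩ := hEW _ _ h₁
    obtain ⟨d₂, m₂⟩ := hEW _ _ h₂
    obtain ⟨d₃, m₃⟩ := hEW _ _ h₃
    obtain ⟨d₄, m₄⟩ := hEW _ _ h₄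
    rw [hζ, hζ, hζ, hζ, ← map_mul (Ideal.Quotient.mk J), ← map_mul (Ideal.Quotient.mk J), Ideal.Quotient.eq]
    refine Ideal.subset_span ⟨?_, ?_, ?_⟩
    · rw [RingHom.mem_ker, map_sub, map_mul (aeval h), map_mul (aeval h), hζsec _ m₁, hζsec _ m₂, hζsec _ m₃,
        hζsec _ m₄]
      refine deh_inj (n := d + d) (((homog_isHomogeneous d _).mul (homog_isHomogeneous d _)).sub
        ((homog_isHomogeneous d _).mul (homog_isHomogeneous d _))) ?_
      rw [map_sub, map_mul deh, map_mul deh, deh_homog d₁, deh_homog d₂, deh_homog d₃, deh_homog d₄, e,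
        sub_self]
    · exact ((hζhom _ m₁).mul (hζhom _ m₂)).sub ((hζhom _ m₃).mul (hζhom _ m₄))
    · exact rankLE_binomial (hζhom _ m₁) (hζhom _ m₂) (hζhom _ m₃) (hζhom _ m₄)
  have hN : ∀ c, 2 ≤ N c := by
    intro c; cases c <;> simp [N] <;> omega
  have hE : ∀ c, (E c).natDegree ≤ N (!c) + 2 := by
    intro c; cases c <;> simp [N, E] <;> omega
  have hEA : (E true).natDegree = N false + 2 := by
    simp [N, E]; omega
  have hgood : ∀ (k : ℕ) (F : MvPolynomial (Fin d) K), F.IsHomogeneous k →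
      Good E N ζ k (Ideal.Quotient.mk J F) (deh (aeval h F)) := by
    intro k F hF
    have hF' : F ∈ (homogeneousSubmodule (Fin d) K 1) ^ k := by
      rw [homogeneousSubmodule_one_pow]; exact hF
    clear hF
    induction hF' using Submodule.pow_induction_on_left' with
    | algebraMap r =>
      have := Good.const hbin r
      rw [AlgHom.commutes, AlgHom.commutes]
      exact this
    | add x y i hx hy h1 h2 =>
      rw [map_add, map_add, map_add]; exact h1.add h2
    | mem_mul m hm i x hx ih =>
      obtain ⟨hm1, hm2⟩ := hζret m hm
      have hmd := ((hmem _).1 hm1).1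
      obtain ⟨p, q, e, hp, hq⟩ := hyper_decomp hab ha hb hAd hBd hcop hA hB hne (deh (aeval h m))
        (deh_natDegree hmd) (hW1 _ hm1)
      have hmk : Ideal.Quotient.mk J m = ζ (E true * p) + ζ (E false * q) := by
        rw [← map_add]
        have : E true * p + E false * q = deh (aeval h m) := by rw [e]; simp [E]
        rw [this, hζ, homog_deh hmd, hm2]
      have h1 := ih.mul_true hbin (p := p) (by simpa [N] using hp)
      have h2 := ih.mul_false hbin (p := q) (by simpa [N] using hq)
      have h3 := h1.add h2
      rw [← add_mul, ← add_mul, ← hmk] at h3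
      rw [map_mul, map_mul, map_mul, e]
      simpa [E] using h3
  have hhomker : ∀ (k : ℕ) (F : MvPolynomial (Fin d) K), F.IsHomogeneous k → aeval h F = 0 →
      F ∈ J := by
    intro k F hF h0
    have hg := hgood k F hF
    rw [h0, map_zero] at hg
    exact Ideal.Quotient.eq_zero_iff_mem.1 (hg.eq_zero hbin hN hE hEA (by simpa [E] using hcop))
  intro F hF
  rw [RingHom.mem_ker] at hF
  rw [← sum_homogeneousComponent F]
  refine Ideal.sum_mem _ fun k hk => hhomker k _ (homogeneousComponent_isHomogeneous k F) ?_
  have h1 : ∀ i, (aeval h (homogeneousComponent i F)).IsHomogeneous (d * i) := fun i =>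
    (homogeneousComponent_isHomogeneous i F).aeval h hhom
  have h2 : homogeneousComponent (d * k) (aeval h F) = aeval h (homogeneousComponent k F) := by
    conv_lhs => rw [← sum_homogeneousComponent F]
    rw [map_sum, map_sum, Finset.sum_eq_single k]
    · rw [homogeneousComponent_of_mem (h1 k), if_pos rfl]
    · intro i _ hi
      rw [homogeneousComponent_of_mem (h1 i), if_neg]
      intro hcon
      exact hi (Nat.eq_of_mul_eq_mul_left (by omega) hcon).symm
    · intro hk'; exact absurd hk hk'
  rw [← h2, hF, map_zero]
end

section
/- Let d ≥ 6 and 3 ≤ c ≤ d−3 be integers. Then the ideal I_{d,c} is generated by homogeneous quadratic polynomials of rank at most 3 contained in I_{d,c}. (In other words, the monomial projection C_{d,c} = π_{e_c}(C_d) ⊂ P^{d−1} satisfies property QR(3), and its rank index equals 3.) -/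
open MvPolynomial

/-- The homogeneous ideal `I_{d,c}` of the monomial projection `π_{e_c}(C_d)`: the kernel of
the map `K[x_i : 0 ≤ i ≤ d, i ≠ c] → K[s,t]`, `x_i ↦ s^{d-i} t^i`. -/
noncomputable def projIdeal (K : Type*) [Field K] (d c : ℕ) :
    Ideal (MvPolynomial {i : Fin (d + 1) // (i : ℕ) ≠ c} K) :=
  RingHom.ker (aeval (fun i : {i : Fin (d + 1) // (i : ℕ) ≠ c} =>
      X 0 ^ (d - (i.1 : ℕ)) * X 1 ^ (i.1 : ℕ)) :
    MvPolynomial {i : Fin (d + 1) // (i : ℕ) ≠ c} K →ₐ[K] MvPolynomial (Fin 2) K)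

/-- The variable `x_m` of the ring `K[x_i : 0 ≤ i ≤ d, i ≠ c]`. -/
noncomputable def xVar (K : Type*) [Field K] (d c m : ℕ) (h1 : m < d + 1) (h2 : m ≠ c) :
    MvPolynomial {i : Fin (d + 1) // (i : ℕ) ≠ c} K :=
  X ⟨⟨m, h1⟩, h2⟩


/-- One-sided part of the quadratic relations (sum `n ≥ 0`), with the missing index moved to `0`. -/
lemma quad_rel_nonneg {Q : Type*} [CommRing Q] (v : Q) (hv : 24 * v = 1) (p q : ℤ) (hp : 3 ≤ p)
    (hq : 3 ≤ q) (y : ℤ → Q)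
    (H1 : ∀ a b m, (-p ≤ a ∧ a ≤ q ∧ a ≠ 0) → (-p ≤ b ∧ b ≤ q ∧ b ≠ 0) → (-p ≤ m ∧ m ≤ q ∧ m ≠ 0) → a + b = 2 * m → y a * y b = y m ^ 2)
    (H2 : ∀ m b k, (-p ≤ (m - b) ∧ (m - b) ≤ q ∧ (m - b) ≠ 0) → (-p ≤ (m + b + k) ∧ (m + b + k) ≤ q ∧ (m + b + k) ≠ 0) → (-p ≤ (m - b + k) ∧ (m - b + k) ≤ q ∧ (m - b + k) ≠ 0) → (-p ≤ (m + b) ∧ (m + b) ≤ q ∧ (m + b) ≠ 0) → (-p ≤ m ∧ m ≤ q ∧ m ≠ 0) → (-p ≤ (m + k) ∧ (m + k) ≤ q ∧ (m + k) ≠ 0) →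
      y (m - b) * y (m + b + k) + y (m - b + k) * y (m + b) = 2 * (y m * y (m + k)))
    (H3 : 4 ≤ q → y (-1) * y 4 = y 1 * y 2)
    (H4 : y (-2) * y 3 = y (-1) * y 2)
    (n : ℤ) (hn : 0 ≤ n) : ∃ w, ∀ i j, (-p ≤ i ∧ i ≤ q ∧ i ≠ 0) → (-p ≤ j ∧ j ≤ q ∧ j ≠ 0) → i + j = n → y i * y j = w := by
  have half : ∀ a b : Q, 2 * a = 2 * b → a = b := by
    intro a b h
    linear_combination 12 * v * h - (a - b) * hv
  have H2' : ∀ m b k i1 i2 i3 i4 i5, (-p ≤ i1 ∧ i1 ≤ q ∧ i1 ≠ 0) → (-p ≤ i2 ∧ i2 ≤ q ∧ i2 ≠ 0) → (-p ≤ i3 ∧ i3 ≤ q ∧ i3 ≠ 0) → (-p ≤ i4 ∧ i4 ≤ q ∧ i4 ≠ 0) → (-p ≤ m ∧ m ≤ q ∧ m ≠ 0) → (-p ≤ i5 ∧ i5 ≤ q ∧ i5 ≠ 0) →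
      i1 = m - b → i2 = m + b + k → i3 = m - b + k → i4 = m + b → i5 = m + k →
      y i1 * y i2 + y i3 * y i4 = 2 * (y m * y i5) := by
    intro m b k i1 i2 i3 i4 i5 h1 h2 h3 h4 h5 h6 e1 e2 e3 e4 e5
    subst e1 e2 e3 e4 e5
    exact H2 m b k h1 h2 h3 h4 h5 h6
  rcases Int.even_or_odd' n with ⟨M, hM | hM⟩
  · by_cases hM0 : M = 0
    · -- n = 0
      have key : ∀ e : ℕ, 1 ≤ e → (-p ≤ (-(e : ℤ)) ∧ (-(e : ℤ)) ≤ q ∧ (-(e : ℤ)) ≠ 0) → (-p ≤ (e : ℤ) ∧ (e : ℤ) ≤ q ∧ (e : ℤ) ≠ 0) →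
          y (-(e : ℤ)) * y (e : ℤ) = y (-1) * y 1 := by
        have a1 := H2' (-2) 1 4 (-3) 3 1 (-1) 2 (by omega) (by omega) (by omega) (by omega)
          (by omega) (by omega) (by norm_num) (by norm_num) (by norm_num) (by norm_num) (by norm_num)
        have a2 := H2' (-1) 2 2 (-3) 3 (-1) 1 1 (by omega) (by omega) (by omega) (by omega)
          (by omega) (by omega) (by norm_num) (by norm_num) (by norm_num) (by norm_num) (by norm_num)
        intro e
        induction e using Nat.strong_induction_on with
        | _ e ih =>
          intro he o1 o2
          rcases (by omega : e = 1 ∨ e = 2 ∨ e = 3 ∨ 4 ≤ e) with h | h | h | h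
          · subst h; norm_num
          · subst h
            apply half
            push_cast
            linear_combination a2 - a1
          · subst h
            push_cast
            linear_combination a2
          · have b1 := H2' (-1) (e - 1) 2 (-(e:ℤ)) e (-((e - 2 : ℕ) : ℤ)) ((e - 2 : ℕ) : ℤ) 1
              o1 o2 (by omega) (by omega) (by omega) (by omega) (by omega) (by omega) (by omega)
              (by omega) (by omega)
            have b2 := ih (e - 2) (by omega) (by omega) (by omega) (by omega)
            linear_combination b1 - b2
      refine ⟨y (-1) * y 1, fun i j hi hj hij => ?_⟩
      rcases le_total i 0 with h | h
      · have := key j.toNat (by omega) (by omega) (by omega)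
        rwa [show -((j.toNat : ℕ) : ℤ) = i by omega, show ((j.toNat : ℕ) : ℤ) = j by omega] at this
      · have := key i.toNat (by omega) (by omega) (by omega)
        rw [show -((i.toNat : ℕ) : ℤ) = j by omega, show ((i.toNat : ℕ) : ℤ) = i by omega] at this
        rw [mul_comm]; exact this
    · exact ⟨y M ^ 2, fun i j hi hj hij => H1 i j M hi hj (by omega) (by omega)⟩
  · have red : ∀ w : Q, (∀ e : ℕ, (-p ≤ (M - e) ∧ (M - e) ≤ q ∧ (M - e) ≠ 0) → (-p ≤ (M + 1 + e) ∧ (M + 1 + e) ≤ q ∧ (M + 1 + e) ≠ 0) → y (M - e) * y (M + 1 + e) = w) →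
        ∃ w, ∀ i j, (-p ≤ i ∧ i ≤ q ∧ i ≠ 0) → (-p ≤ j ∧ j ≤ q ∧ j ≠ 0) → i + j = n → y i * y j = w := by
      intro w key
      refine ⟨w, fun i j hi hj hij => ?_⟩
      rcases le_total i M with h | h
      · have := key (M - i).toNat (by omega) (by omega)
        rwa [show M - (((M - i).toNat : ℕ) : ℤ) = i by omega,
          show M + 1 + (((M - i).toNat : ℕ) : ℤ) = j by omega] at this
      · have hj' : j ≤ M ∨ (i = M) := by omega
        rcases hj' with h' | h'
        · have := key (M - j).toNat (by omega) (by omega)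
          rw [show M - (((M - j).toNat : ℕ) : ℤ) = j by omega,
            show M + 1 + (((M - j).toNat : ℕ) : ℤ) = i by omega] at this
          rw [mul_comm]; exact this
        · have := key 0 (by omega) (by omega)
          rwa [show M - ((0 : ℕ) : ℤ) = i by omega,
            show M + 1 + ((0 : ℕ) : ℤ) = j by omega] at this
    rcases (by omega : M = 0 ∨ M = 1 ∨ 2 ≤ M) with h | h | h
    · subst h
      apply red (y (-1) * y 2)
      intro e
      induction e using Nat.strong_induction_on with
      | _ e ih =>
        intro o1 o2
        rcases (by omega : e = 0 ∨ e = 1 ∨ e = 2 ∨ e = 3 ∨ 4 ≤ e) with h | h | h | h | h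
        · omega
        · subst h; norm_num
        · subst h; norm_num; exact H4
        · subst h
          have b1 := H2' (-2) 1 5 (-3) 4 2 (-1) 3 (by omega) (by omega) (by omega) (by omega)
            (by omega) (by omega) (by norm_num) (by norm_num) (by norm_num) (by norm_num) (by norm_num)
          norm_num
          linear_combination b1 + 2 * H4
        · have b1 := H2' (-1) (e - 1) 3 (0 - e) (0 + 1 + e) (0 - ((e - 3 : ℕ) : ℤ))
            (0 + 1 + ((e - 3 : ℕ) : ℤ)) 2
            o1 o2 (by omega) (by omega) (by omega) (by omega) (by omega) (by omega) (by omega)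
            (by omega) (by omega)
          have b2 := ih (e - 3) (by omega) (by omega) (by omega)
          linear_combination b1 - b2
    · subst h
      apply red (y 1 * y 2)
      intro e
      induction e using Nat.strong_induction_on with
      | _ e ih =>
        intro o1 o2
        rcases (by omega : e = 0 ∨ e = 1 ∨ e = 2 ∨ 3 ≤ e) with h | h | h | h
        · subst h; norm_num
        · omega
        · subst h; norm_num; exact H3 (by omega)
        · have b1 := H2' 1 e 1 (1 - e) (1 + 1 + e) (1 - ((e - 1 : ℕ) : ℤ))
            (1 + 1 + ((e - 1 : ℕ) : ℤ)) 2
            o1 o2 (by omega) (by omega) (by omega) (by omega) (by omega) (by omega) (by omega)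
            (by omega) (by omega)
          have b2 := ih (e - 1) (by omega) (by omega) (by omega)
          linear_combination b1 - b2
    · apply red (y M * y (M + 1))
      intro e
      induction e using Nat.strong_induction_on with
      | _ e ih =>
        intro o1 o2
        rcases (by omega : e = 0 ∨ 1 ≤ e ∧ (e : ℤ) ≠ M + 1 ∨ (e : ℤ) = M + 1) with h | h | h
        · subst h; norm_num
        · have b1 := H2' M e 1 (M - e) (M + 1 + e) (M - ((e - 1 : ℕ) : ℤ))
            (M + 1 + ((e - 1 : ℕ) : ℤ)) (M + 1)
            o1 o2 (by omega) (by omega) (by omega) (by omega) (by omega) (by omega) (by omega)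
            (by omega) (by omega)
          have b2 := ih (e - 1) (by omega) (by omega) (by omega)
          linear_combination b1 - b2
        · have b1 := H2' (M - 1) M 3 (M - e) (M + 1 + e) (M - ((e - 3 : ℕ) : ℤ))
            (M + 1 + ((e - 3 : ℕ) : ℤ)) (M + 1 + ((1 : ℕ) : ℤ))
            o1 o2 (by omega) (by omega) (by omega) (by omega) (by omega) (by omega) (by omega)
            (by omega) (by omega)
          have b2 := ih (e - 3) (by omega) (by omega) (by omega)
          have b3 := ih 1 (by omega) (by omega) (by omega)
          rw [show M - ((1 : ℕ) : ℤ) = M - 1 by norm_num] at b3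
          linear_combination b1 - b2 + 2 * b3

lemma quad_rel {Q : Type*} [CommRing Q] (v : Q) (hv : 24 * v = 1) (p q : ℤ) (hp : 3 ≤ p)
    (hq : 3 ≤ q) (y : ℤ → Q)
    (H1 : ∀ a b m, (-p ≤ a ∧ a ≤ q ∧ a ≠ 0) → (-p ≤ b ∧ b ≤ q ∧ b ≠ 0) → (-p ≤ m ∧ m ≤ q ∧ m ≠ 0) → a + b = 2 * m → y a * y b = y m ^ 2)
    (H2 : ∀ m b k, (-p ≤ (m - b) ∧ (m - b) ≤ q ∧ (m - b) ≠ 0) → (-p ≤ (m + b + k) ∧ (m + b + k) ≤ q ∧ (m + b + k) ≠ 0) → (-p ≤ (m - b + k) ∧ (m - b + k) ≤ q ∧ (m - b + k) ≠ 0) → (-p ≤ (m + b) ∧ (m + b) ≤ q ∧ (m + b) ≠ 0) → (-p ≤ m ∧ m ≤ q ∧ m ≠ 0) → (-p ≤ (m + k) ∧ (m + k) ≤ q ∧ (m + k) ≠ 0) →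
      y (m - b) * y (m + b + k) + y (m - b + k) * y (m + b) = 2 * (y m * y (m + k)))
    (H3 : 4 ≤ q → y (-1) * y 4 = y 1 * y 2)
    (H3' : 4 ≤ p → y 1 * y (-4) = y (-1) * y (-2))
    (H4 : y (-2) * y 3 = y (-1) * y 2)
    (H4' : y 2 * y (-3) = y 1 * y (-2))
    (i j k l : ℤ) (hi : (-p ≤ i ∧ i ≤ q ∧ i ≠ 0)) (hj : (-p ≤ j ∧ j ≤ q ∧ j ≠ 0)) (hk : (-p ≤ k ∧ k ≤ q ∧ k ≠ 0)) (hl : (-p ≤ l ∧ l ≤ q ∧ l ≠ 0)) (h : i + j = k + l) :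
    y i * y j = y k * y l := by
  rcases le_total 0 (i + j) with hn | hn
  · obtain ⟨w, hw⟩ := quad_rel_nonneg v hv p q hp hq y H1 H2 H3 H4 (i + j) hn
    rw [hw i j hi hj rfl, hw k l hk hl h.symm]
  · obtain ⟨w, hw⟩ := quad_rel_nonneg v hv q p hq hp (fun i => y (-i))
      (by
        intro a b m ha hb hm e
        exact H1 _ _ _ (by omega) (by omega) (by omega) (by omega))
      (by
        intro m b k h1 h2 h3 h4 h5 h6
        have := H2 (-m) (-b) (-k) (by omega) (by omega) (by omega) (by omega) (by omega) (by omega)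
        convert this using 4 <;> ring)
      (by intro h; simpa using H3' h)
      (by simpa using H4') (-(i + j)) (by omega)
    have h1 := hw (-i) (-j) (by omega) (by omega) (by omega)
    have h2 := hw (-k) (-l) (by omega) (by omega) (by omega)
    simp only [neg_neg] at h1 h2
    rw [h1, h2]

/-- Normal forms of products of `D` elements with index sum `N`. -/
def IsNF {Q : Type*} [CommRing Q] (d c : ℤ) (y : ℤ → Q) (D N : ℕ) (z : Q) : Prop :=
  (D = 0 ∧ N = 0 ∧ z = 1) ∨
  (∃ a b : ℕ, ∃ k : ℤ, 0 ≤ k ∧ k ≤ d ∧ k ≠ c ∧ D = a + b + 1 ∧ (N : ℤ) = k + b * d ∧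
    z = y 0 ^ a * y d ^ b * y k) ∨
  (∃ a b : ℕ, D = a + b + 2 ∧ (N : ℤ) = c + b * d ∧ z = y 0 ^ a * y d ^ b * (y 1 * y (c - 1))) ∨
  (∃ a b : ℕ, D = a + b + 2 ∧ (N : ℤ) = c + (b + 1) * d ∧
    z = y 0 ^ a * y d ^ b * (y (c + 1) * y (d - 1)))

lemma IsNF.mulI {Q : Type*} [CommRing Q] (d c : ℤ) (hc : 3 ≤ c) (hd : c ≤ d - 3) (y : ℤ → Q)
    (H : ∀ i j k l : ℤ, (0 ≤ i ∧ i ≤ d ∧ i ≠ c) → (0 ≤ j ∧ j ≤ d ∧ j ≠ c) →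
      (0 ≤ k ∧ k ≤ d ∧ k ≠ c) → (0 ≤ l ∧ l ≤ d ∧ l ≠ c) → i + j = k + l → y i * y j = y k * y l)
    (D N : ℕ) (z : Q) (i : ℤ) (hi : 0 ≤ i ∧ i ≤ d ∧ i ≠ c) (a b : ℕ) (k : ℤ)
    (hk : 0 ≤ k ∧ k ≤ d ∧ k ≠ c) (hD : D = a + b + 2) (hN : (N : ℤ) = i + k + b * d)
    (hz : z = y 0 ^ a * y d ^ b * (y i * y k)) : IsNF d c y D N z := by
  by_cases h1 : i + k = c
  · right; right; left
    refine ⟨a, b, hD, by rw [hN, h1], ?_⟩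
    rw [hz, H i k 1 (c - 1) hi hk (by omega) (by omega) (by omega)]
  by_cases h2 : i + k = c + d
  · right; right; right
    refine ⟨a, b, hD, by rw [hN, h2]; ring, ?_⟩
    rw [hz, H i k (c + 1) (d - 1) hi hk (by omega) (by omega) (by omega)]
  right; left
  by_cases h3 : i + k ≤ d
  · refine ⟨a + 1, b, i + k, by omega, by omega, by omega, by omega, hN, ?_⟩
    rw [hz, H i k 0 (i + k) hi hk (by omega) (by omega) (by omega)]
    ring
  · refine ⟨a, b + 1, i + k - d, by omega, by omega, by omega, by omega, ?_, ?_⟩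
    · rw [hN]; push_cast; ring
    rw [hz, H i k d (i + k - d) hi hk (by omega) (by omega) (by omega)]
    ring

lemma IsNF.mul {Q : Type*} [CommRing Q] (d c : ℤ) (hc : 3 ≤ c) (hd : c ≤ d - 3) (y : ℤ → Q)
    (H : ∀ i j k l : ℤ, (0 ≤ i ∧ i ≤ d ∧ i ≠ c) → (0 ≤ j ∧ j ≤ d ∧ j ≠ c) →
      (0 ≤ k ∧ k ≤ d ∧ k ≠ c) → (0 ≤ l ∧ l ≤ d ∧ l ≠ c) → i + j = k + l → y i * y j = y k * y l)
    (D N : ℕ) (z : Q) (i : ℕ) (hi : 0 ≤ (i : ℤ) ∧ (i : ℤ) ≤ d ∧ (i : ℤ) ≠ c)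
    (hz : IsNF d c y D N z) : IsNF d c y (D + 1) (N + i) (z * y i) := by
  rcases hz with ⟨rfl, rfl, rfl⟩ | ⟨a, b, k, h1, h2, h3, hD, hN, rfl⟩ | ⟨a, b, hD, hN, rfl⟩ |
    ⟨a, b, hD, hN, rfl⟩
  · right; left
    exact ⟨0, 0, i, hi.1, hi.2.1, hi.2.2, by simp, by simp, by simp⟩
  · exact IsNF.mulI d c hc hd y H _ _ _ i hi a b k ⟨h1, h2, h3⟩ (by omega)
      (by push_cast; rw [hN]; ring) (by ring)
  · by_cases e : (i : ℤ) = 1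
    · refine IsNF.mulI d c hc hd y H _ _ _ (c - 1) (by omega) (a + 1) b 2 (by omega) (by omega)
        (by push_cast; rw [hN, e]; ring) ?_
      rw [e]
      have := H 1 1 0 2 (by omega) (by omega) (by omega) (by omega) (by omega)
      linear_combination (y 0 ^ a * y d ^ b * y (c - 1)) * this
    by_cases e2 : i + c - 1 ≤ d
    · refine IsNF.mulI d c hc hd y H _ _ _ 1 (by omega) (a + 1) b (i + c - 1) (by omega) (by omega)
        (by push_cast; rw [hN]; ring) ?_
      have := H i (c - 1) 0 (i + c - 1) (by omega) (by omega) (by omega) (by omega) (by omega)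
      linear_combination (y 0 ^ a * y d ^ b * y 1) * this
    · refine IsNF.mulI d c hc hd y H _ _ _ 1 (by omega) a (b + 1) (i + c - 1 - d) (by omega)
        (by omega) (by push_cast; rw [hN]; ring) ?_
      have := H i (c - 1) d (i + c - 1 - d) (by omega) (by omega) (by omega) (by omega) (by omega)
      linear_combination (y 0 ^ a * y d ^ b * y 1) * this
  · by_cases e : (i : ℤ) = d - 1
    · refine IsNF.mulI d c hc hd y H _ _ _ (c + 1) (by omega) a (b + 1) (d - 2) (by omega) (by omega)
        (by push_cast; rw [hN, e]; ring) ?_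
      rw [e]
      have := H (d - 1) (d - 1) d (d - 2) (by omega) (by omega) (by omega) (by omega) (by omega)
      linear_combination (y 0 ^ a * y d ^ b * y (c + 1)) * this
    by_cases e2 : i + c + 1 ≤ d
    · refine IsNF.mulI d c hc hd y H _ _ _ (d - 1) (by omega) (a + 1) b (i + c + 1) (by omega)
        (by omega) (by push_cast; rw [hN]; ring) ?_
      have := H i (c + 1) 0 (i + c + 1) (by omega) (by omega) (by omega) (by omega) (by omega)
      linear_combination (y 0 ^ a * y d ^ b * y (d - 1)) * this
    · refine IsNF.mulI d c hc hd y H _ _ _ (d - 1) (by omega) a (b + 1) (i + c + 1 - d) (by omega)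
        (by omega) (by push_cast; rw [hN]; ring) ?_
      have := H i (c + 1) d (i + c + 1 - d) (by omega) (by omega) (by omega) (by omega) (by omega)
      linear_combination (y 0 ^ a * y d ^ b * y (d - 1)) * this

lemma div_unique_aux (d : ℤ) (k k' : ℤ) (b b' : ℤ) (hd : 0 < d) (hk : 0 ≤ k) (hk2 : k ≤ d)
    (hk' : 0 ≤ k') (hk2' : k' ≤ d) (h : k + b * d = k' + b' * d) :
    (b = b' ∧ k = k') ∨ (b = b' + 1 ∧ k = 0 ∧ k' = d) ∨ (b' = b + 1 ∧ k' = 0 ∧ k = d) := by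
  have h1 : b - b' ≤ 1 := by by_contra! hh; nlinarith
  have h2 : b' - b ≤ 1 := by by_contra! hh; nlinarith
  rcases (by omega : b = b' ∨ b = b' + 1 ∨ b' = b + 1) with e | e | e
  · subst e; left; exact ⟨rfl, by linarith⟩
  · right; left; subst e; refine ⟨rfl, ?_, ?_⟩ <;> nlinarith
  · right; right; subst e; refine ⟨rfl, ?_, ?_⟩ <;> nlinarith

lemma IsNF.unique {Q : Type*} [CommRing Q] (d c : ℤ) (hc : 3 ≤ c) (hd : c ≤ d - 3) (y : ℤ → Q)
    (H : ∀ i j k l : ℤ, (0 ≤ i ∧ i ≤ d ∧ i ≠ c) → (0 ≤ j ∧ j ≤ d ∧ j ≠ c) →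
      (0 ≤ k ∧ k ≤ d ∧ k ≠ c) → (0 ≤ l ∧ l ≤ d ∧ l ≠ c) → i + j = k + l → y i * y j = y k * y l)
    (D N : ℕ) (z z' : Q) (hz : IsNF d c y D N z) (hz' : IsNF d c y D N z') : z = z' := by
  have h23 : ∀ a b a' b' : ℕ, a + b = a' + b' → (c + b * d = c + (b' + 1) * d) →
      y 0 ^ a * y d ^ b * (y 1 * y (c - 1)) = y 0 ^ a' * y d ^ b' * (y (c + 1) * y (d - 1)) := by
    intro a b a' b' h1 h2
    rcases div_unique_aux d c c b (b' + 1) (by omega) (by omega) (by omega) (by omega) (by omega) h2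
      with h | h | h
    · obtain rfl : b = b' + 1 := by omega
      obtain rfl : a' = a + 1 := by omega
      have e1 := H 1 d 2 (d - 1) (by omega) (by omega) (by omega) (by omega) (by omega)
      have e2 := H 2 (c - 1) 0 (c + 1) (by omega) (by omega) (by omega) (by omega) (by omega)
      linear_combination (y 0 ^ a * y d ^ b' * y (c - 1)) * e1 + (y 0 ^ a * y d ^ b' * y (d - 1)) * e2
    · omega
    · omega
  have hd0 : 0 < d := by omega
  rcases hz with ⟨rfl, rfl, rfl⟩ | ⟨a, b, k, h1, h2, h3, hD, hN, rfl⟩ | ⟨a, b, hD, hN, rfl⟩ |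
    ⟨a, b, hD, hN, rfl⟩ <;>
  rcases hz' with ⟨hD', hN', rfl⟩ | ⟨a', b', k', h1', h2', h3', hD', hN', rfl⟩ |
    ⟨a', b', hD', hN', rfl⟩ | ⟨a', b', hD', hN', rfl⟩
  all_goals try (exfalso; omega)
  · rfl
  · rw [hN] at hN'
    rcases div_unique_aux d k k' b b' hd0 h1 h2 h1' h2' hN' with ⟨h, rfl⟩ | ⟨h, rfl, rfl⟩ | ⟨h, rfl, rfl⟩
    · obtain rfl : b = b' := by omega
      obtain rfl : a = a' := by omega
      rfl
    · obtain rfl : b = b' + 1 := by omega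
      obtain rfl : a' = a + 1 := by omega
      ring
    · obtain rfl : b' = b + 1 := by omega
      obtain rfl : a = a' + 1 := by omega
      ring
  · rw [hN] at hN'
    rcases div_unique_aux d k c b b' hd0 h1 h2 (by omega) (by omega) hN' with h | h | h <;> omega
  · rw [hN] at hN'
    rcases div_unique_aux d k c b (b' + 1) hd0 h1 h2 (by omega) (by omega) hN' with h | h | h <;> omega
  · rw [hN] at hN'
    rcases div_unique_aux d c k' b b' hd0 (by omega) (by omega) h1' h2' hN' with h | h | h <;> omega
  · rw [hN] at hN'
    rcases div_unique_aux d c c b b' hd0 (by omega) (by omega) (by omega) (by omega) hN' with h | h | h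
    · obtain rfl : b = b' := by omega
      obtain rfl : a = a' := by omega
      rfl
    · omega
    · omega
  · exact h23 a b a' b' (by omega) (by rw [← hN, ← hN'])
  · rw [hN] at hN'
    rcases div_unique_aux d c k' (b + 1) b' hd0 (by omega) (by omega) h1' h2' hN' with h | h | h <;> omega
  · exact (h23 a' b' a b (by omega) (by rw [← hN, ← hN'])).symm
  · rw [hN] at hN'
    rcases div_unique_aux d c c (b + 1) (b' + 1) hd0 (by omega) (by omega) (by omega) (by omega) hN'
      with h | h | h
    · obtain rfl : b = b' := by omega
      obtain rfl : a = a' := by omega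
      rfl
    · omega
    · omega

/-- `A * B - C ^ 2` has rank at most three. -/
lemma rankLE_mul_sub_sq {K : Type*} [Field K] [IsAlgClosed K] [CharZero K] {σ : Type*}
    (A B C' : MvPolynomial σ K) (hA : A.IsHomogeneous 1) (hB : B.IsHomogeneous 1)
    (hC : C'.IsHomogeneous 1) : rankLE 3 (A * B - C' ^ 2) := by
  obtain ⟨I, hI⟩ := IsAlgClosed.exists_pow_nat_eq (-1 : K) (n := 2) (by norm_num)
  have hC2 : (C I : MvPolynomial σ K) ^ 2 = -1 := by rw [← C_pow, hI]; simp
  have h2 : (2 : MvPolynomial σ K) * C (1 / 2 : K) = 1 := by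
    rw [show (2 : MvPolynomial σ K) = C 2 from (map_ofNat C 2).symm, ← C_mul]; simp
  refine ⟨![C (1 / 2) * (A + B), C I * (C (1 / 2) * (A - B)), C I * C'], ?_, ?_⟩
  · intro i
    have hs : ∀ (a : K) (L : MvPolynomial σ K), L.IsHomogeneous 1 → (C a * L).IsHomogeneous 1 := by
      intro a L hL
      have := (isHomogeneous_C σ a).mul hL
      simpa using this
    fin_cases i
    · exact hs _ _ (hA.add hB)
    · exact hs _ _ (hs _ _ (hA.sub hB))
    · exact hs _ _ hC
  · simp only [Fin.sum_univ_three, Matrix.cons_val_zero, Matrix.cons_val_one, Matrix.cons_val]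
    set h := (C (1 / 2 : K) : MvPolynomial σ K)
    set J := (C I : MvPolynomial σ K)
    linear_combination (-(A * B)) * (1 + 2 * h) * h2 - (h ^ 2 * (A - B) ^ 2 + C' ^ 2) * hC2


/-- The quadratic relations follow from the vanishing of `A * B - C ^ 2` for suitable
linear combinations. `ev` is the parametrization, `mk` the quotient map. -/
lemma rel_of_rank_three {R Q S : Type*} [CommRing R] [CommRing Q] [CommRing S]
    (mk : R →+* Q) (ev : R →+* S) (v : Q) (hv : 24 * v = 1) (p q : ℤ) (hp : 3 ≤ p) (hq : 3 ≤ q)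
    (x : ℤ → R) (Lin : R → Prop) (hx : ∀ i, Lin (x i))
    (hadd : ∀ a b, Lin a → Lin b → Lin (a + b)) (hsub : ∀ a b, Lin a → Lin b → Lin (a - b))
    (hmul : ∀ (n : ℕ) a, Lin a → Lin ((n : R) * a))
    (hg : ∀ i j k l : ℤ, (-p ≤ i ∧ i ≤ q ∧ i ≠ 0) → (-p ≤ j ∧ j ≤ q ∧ j ≠ 0) →
      (-p ≤ k ∧ k ≤ q ∧ k ≠ 0) → (-p ≤ l ∧ l ≤ q ∧ l ≠ 0) → i + j = k + l →
      ev (x i) * ev (x j) = ev (x k) * ev (x l))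
    (key : ∀ A B C', Lin A → Lin B → Lin C' → ev A * ev B = ev C' ^ 2 → mk A * mk B = mk C' ^ 2)
    (i j k l : ℤ) (hi : -p ≤ i ∧ i ≤ q ∧ i ≠ 0) (hj : -p ≤ j ∧ j ≤ q ∧ j ≠ 0)
    (hk : -p ≤ k ∧ k ≤ q ∧ k ≠ 0) (hl : -p ≤ l ∧ l ≤ q ∧ l ≠ 0) (h : i + j = k + l) :
    mk (x i) * mk (x j) = mk (x k) * mk (x l) := by
  have H1 : ∀ a b m, (-p ≤ a ∧ a ≤ q ∧ a ≠ 0) → (-p ≤ b ∧ b ≤ q ∧ b ≠ 0) →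
      (-p ≤ m ∧ m ≤ q ∧ m ≠ 0) → a + b = 2 * m → mk (x a) * mk (x b) = mk (x m) ^ 2 := by
    intro a b m ha hb hm e
    apply key _ _ _ (hx _) (hx _) (hx _)
    rw [sq]
    exact hg _ _ _ _ ha hb hm hm (by omega)
  -- the relation of weights `e i`, `i = -2, -1, 1, 2, 3, 4` (up to a sign `e`)
  have H3 : ∀ e : ℤ, (e = 1 ∨ e = -1) → (-p ≤ 4 * e ∧ 4 * e ≤ q) →
      mk (x (-1 * e)) * mk (x (4 * e)) = mk (x (1 * e)) * mk (x (2 * e)) := by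
    intro e he h4
    have gg : ∀ s t u w : ℤ, (-2 ≤ s ∧ s ≤ 4 ∧ s ≠ 0) → (-2 ≤ t ∧ t ≤ 4 ∧ t ≠ 0) →
        (-2 ≤ u ∧ u ≤ 4 ∧ u ≠ 0) → (-2 ≤ w ∧ w ≤ 4 ∧ w ≠ 0) → s + t = u + w →
        ev (x (s * e)) * ev (x (t * e)) = ev (x (u * e)) * ev (x (w * e)) := by
      intro s t u w h1 h2 h3 h5 h6
      rcases he with rfl | rfl <;> exact hg _ _ _ _ (by omega) (by omega) (by omega) (by omega) (by omega)
    have g1 := gg 4 (-2) 1 1 (by omega) (by omega) (by omega) (by omega) (by omega)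
    have g2 := gg 4 (-1) 1 2 (by omega) (by omega) (by omega) (by omega) (by omega)
    have g3 := gg 4 1 2 3 (by omega) (by omega) (by omega) (by omega) (by omega)
    have g4 := gg 4 2 3 3 (by omega) (by omega) (by omega) (by omega) (by omega)
    have g5 := gg 1 3 2 2 (by omega) (by omega) (by omega) (by omega) (by omega)
    have r1 := key (x (4 * e))
      (x (-2 * e) + ((4 : ℕ) : R) * x (-1 * e) - ((8 : ℕ) : R) * x (1 * e) + ((4 : ℕ) : R) * x (2 * e))
      (x (1 * e) + ((2 : ℕ) : R) * x (2 * e) - ((2 : ℕ) : R) * x (3 * e)) (hx _)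
      (hadd _ _ (hsub _ _ (hadd _ _ (hx _) (hmul _ _ (hx _))) (hmul _ _ (hx _))) (hmul _ _ (hx _)))
      (hsub _ _ (hadd _ _ (hx _) (hmul _ _ (hx _))) (hmul _ _ (hx _)))
      (by
        simp only [map_add, map_sub, map_mul, map_natCast]
        push_cast
        linear_combination g1 + 4 * g2 - 8 * g3 + 4 * g4 + 4 * g5)
    have r2 := key (x (4 * e))
      (x (-2 * e) + ((8 : ℕ) : R) * x (-1 * e) - ((64 : ℕ) : R) * x (1 * e) + ((64 : ℕ) : R) * x (2 * e))
      (x (1 * e) + ((4 : ℕ) : R) * x (2 * e) - ((8 : ℕ) : R) * x (3 * e)) (hx _)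
      (hadd _ _ (hsub _ _ (hadd _ _ (hx _) (hmul _ _ (hx _))) (hmul _ _ (hx _))) (hmul _ _ (hx _)))
      (hsub _ _ (hadd _ _ (hx _) (hmul _ _ (hx _))) (hmul _ _ (hx _)))
      (by
        simp only [map_add, map_sub, map_mul, map_natCast]
        push_cast
        linear_combination g1 + 8 * g2 - 64 * g3 + 64 * g4 + 16 * g5)
    simp only [map_add, map_sub, map_mul, map_natCast] at r1 r2
    push_cast at r1 r2
    have hh : ∀ s t u : ℤ, (-2 ≤ s ∧ s ≤ 4 ∧ s ≠ 0) → (-2 ≤ t ∧ t ≤ 4 ∧ t ≠ 0) →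
        (-2 ≤ u ∧ u ≤ 4 ∧ u ≠ 0) → s + t = 2 * u →
        mk (x (s * e)) * mk (x (t * e)) = mk (x (u * e)) ^ 2 := by
      intro s t u h1 h2 h3 h6
      rcases he with rfl | rfl <;> exact H1 _ _ _ (by omega) (by omega) (by omega) (by omega)
    have m1 := hh 4 (-2) 1 (by omega) (by omega) (by omega) (by omega)
    have m4 := hh 4 2 3 (by omega) (by omega) (by omega) (by omega)
    have m5 := hh 1 3 2 (by omega) (by omega) (by omega) (by omega)
    have t1 : 4 * (mk (x (4 * e)) * mk (x (-1 * e)) - mk (x (1 * e)) * mk (x (2 * e)))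
        = 8 * (mk (x (4 * e)) * mk (x (1 * e)) - mk (x (2 * e)) * mk (x (3 * e))) := by
      linear_combination r1 - m1 - 4 * m4 - 4 * m5
    have t2 : 8 * (mk (x (4 * e)) * mk (x (-1 * e)) - mk (x (1 * e)) * mk (x (2 * e)))
        = 64 * (mk (x (4 * e)) * mk (x (1 * e)) - mk (x (2 * e)) * mk (x (3 * e))) := by
      linear_combination r2 - m1 - 64 * m4 - 16 * m5
    linear_combination (8 * t1 - t2) * v -
      (mk (x (4 * e)) * mk (x (-1 * e)) - mk (x (1 * e)) * mk (x (2 * e))) * hv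
  have gg : ∀ s t u w : ℤ, (-3 ≤ s ∧ s ≤ 3 ∧ s ≠ 0) → (-3 ≤ t ∧ t ≤ 3 ∧ t ≠ 0) →
      (-3 ≤ u ∧ u ≤ 3 ∧ u ≠ 0) → (-3 ≤ w ∧ w ≤ 3 ∧ w ≠ 0) → s + t = u + w →
      ev (x s) * ev (x t) = ev (x u) * ev (x w) := by
    intro s t u w h1 h2 h3 h5 h6
    exact hg _ _ _ _ (by omega) (by omega) (by omega) (by omega) (by omega)
  have H4 : mk (x (-2)) * mk (x 3) = mk (x (-1)) * mk (x 2) ∧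
      mk (x 2) * mk (x (-3)) = mk (x 1) * mk (x (-2)) := by
    have g1 := gg (-3) 1 (-1) (-1) (by omega) (by omega) (by omega) (by omega) (by omega)
    have g2 := gg (-2) 1 (-3) 2 (by omega) (by omega) (by omega) (by omega) (by omega)
    have g3 := gg (-3) 3 (-1) 1 (by omega) (by omega) (by omega) (by omega) (by omega)
    have g4 := gg (-2) 2 (-1) 1 (by omega) (by omega) (by omega) (by omega) (by omega)
    have g5 := gg (-2) 3 (-1) 2 (by omega) (by omega) (by omega) (by omega) (by omega)
    have g6 := gg (-1) 3 1 1 (by omega) (by omega) (by omega) (by omega) (by omega)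
    have P : ∀ s t : ℕ, t = s ^ 2 →
        mk (x (-3) + ((2 * s : ℕ) : R) * x (-2) + (t : R) * x (-1)) *
          mk (x 1 - ((2 * s : ℕ) : R) * x 2 + (t : R) * x 3) = mk (x (-1) - (t : R) * x 1) ^ 2 := by
      intro s t hst
      apply key _ _ _ (hadd _ _ (hadd _ _ (hx _) (hmul _ _ (hx _))) (hmul _ _ (hx _)))
        (hadd _ _ (hsub _ _ (hx _) (hmul _ _ (hx _))) (hmul _ _ (hx _)))
        (hsub _ _ (hx _) (hmul _ _ (hx _)))
      simp only [map_add, map_sub, map_mul, map_natCast]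
      subst hst
      push_cast
      linear_combination g1 + 2 * (s : S) * g2 + (s : S) ^ 2 * (g3 - 4 * g4) + 2 * (s : S) ^ 3 * g5
        + (s : S) ^ 4 * g6
    have P' : ∀ s t : ℕ, t = s ^ 2 →
        mk (x (-3) - ((2 * s : ℕ) : R) * x (-2) + (t : R) * x (-1)) *
          mk (x 1 + ((2 * s : ℕ) : R) * x 2 + (t : R) * x 3) = mk (x (-1) - (t : R) * x 1) ^ 2 := by
      intro s t hst
      apply key _ _ _ (hadd _ _ (hsub _ _ (hx _) (hmul _ _ (hx _))) (hmul _ _ (hx _)))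
        (hadd _ _ (hadd _ _ (hx _) (hmul _ _ (hx _))) (hmul _ _ (hx _)))
        (hsub _ _ (hx _) (hmul _ _ (hx _)))
      simp only [map_add, map_sub, map_mul, map_natCast]
      subst hst
      push_cast
      linear_combination g1 - 2 * (s : S) * g2 + (s : S) ^ 2 * (g3 - 4 * g4) - 2 * (s : S) ^ 3 * g5
        + (s : S) ^ 4 * g6
    have p1 := P 1 1 (by norm_num)
    have p2 := P 2 4 (by norm_num)
    have p1' := P' 1 1 (by norm_num)
    have p2' := P' 2 4 (by norm_num)
    simp only [map_add, map_sub, map_mul, map_natCast] at p1 p2 p1' p2'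
    push_cast at p1 p2 p1' p2'
    have t1 : 4 * (mk (x (-2)) * mk (x 1) - mk (x (-3)) * mk (x 2)) +
        4 * (mk (x (-2)) * mk (x 3) - mk (x (-1)) * mk (x 2)) = 0 := by
      linear_combination p1 - p1'
    have t2 : 8 * (mk (x (-2)) * mk (x 1) - mk (x (-3)) * mk (x 2)) +
        32 * (mk (x (-2)) * mk (x 3) - mk (x (-1)) * mk (x 2)) = 0 := by
      linear_combination p2 - p2'
    constructor
    · linear_combination (t2 - 2 * t1) * v -
        (mk (x (-2)) * mk (x 3) - mk (x (-1)) * mk (x 2)) * hv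
    · linear_combination -(8 * t1 - t2) * v +
        (mk (x (-2)) * mk (x 1) - mk (x (-3)) * mk (x 2)) * hv
  refine quad_rel v hv p q hp hq (fun i => mk (x i)) H1 ?_ ?_ ?_ H4.1 H4.2 i j k l hi hj hk hl h
  · intro m b k h1 h2 h3 h4 h5 h6
    have r := key (x (m - b) + x (m - b + k)) (x (m + b) + x (m + b + k)) (x m + x (m + k))
      (hadd _ _ (hx _) (hx _)) (hadd _ _ (hx _) (hx _)) (hadd _ _ (hx _) (hx _))
      (by
        simp only [map_add]
        have g1 := hg _ _ _ _ h1 h4 h5 h5 (by ring)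
        have g2 := hg _ _ _ _ h1 h2 h5 h6 (by ring)
        have g3 := hg _ _ _ _ h3 h4 h5 h6 (by ring)
        have g4 := hg _ _ _ _ h3 h2 h6 h6 (by ring)
        linear_combination g1 + g2 + g3 + g4)
    simp only [map_add] at r
    have m1 := H1 _ _ _ h1 h4 h5 (by ring)
    have m2 := H1 _ _ _ h3 h2 h6 (by ring)
    linear_combination r - m1 - m2
  · intro h4
    simpa using H3 1 (Or.inl rfl) (by omega)
  · intro h4
    simpa using H3 (-1) (Or.inr rfl) (by omega)

/-- Toric reduction: the kernel is generated by relations that identify monomials with the same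
image. -/
lemma ker_le_of_monomials {K σ : Type*} [Field K] (ev : MvPolynomial σ K →ₐ[K] MvPolynomial (Fin 2) K)
    (E : (σ →₀ ℕ) → (Fin 2 →₀ ℕ)) (hE : ∀ m, ev (monomial m 1) = monomial (E m) 1)
    (J : Ideal (MvPolynomial σ K))
    (hJ : ∀ m m', E m = E m' →
      Ideal.Quotient.mk J (monomial m 1) = Ideal.Quotient.mk J (monomial m' 1)) :
    RingHom.ker ev ≤ J := by
  classical
  let rep : (Fin 2 →₀ ℕ) → (MvPolynomial σ K ⧸ J) := fun w =>
    if h : ∃ m, E m = w then Ideal.Quotient.mk J (monomial h.choose 1) else 0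
  let Φ : MvPolynomial (Fin 2) K →ₗ[K] (MvPolynomial σ K ⧸ J) :=
    (basisMonomials (Fin 2) K).constr K rep
  have hΦ : ∀ w, Φ (monomial w 1) = rep w := by
    intro w
    have := (basisMonomials (Fin 2) K).constr_basis K rep w
    rwa [coe_basisMonomials] at this
  have hlin : (Ideal.Quotient.mkₐ K J).toLinearMap = Φ ∘ₗ ev.toLinearMap := by
    apply (basisMonomials σ K).ext
    intro m
    rw [coe_basisMonomials]
    simp only [LinearMap.comp_apply, AlgHom.toLinearMap_apply, hE, hΦ, rep]
    have hm : ∃ m', E m' = E m := ⟨m, rfl⟩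
    rw [dif_pos hm]
    exact hJ _ _ hm.choose_spec.symm
  intro P hP
  rw [RingHom.mem_ker] at hP
  have := LinearMap.congr_fun hlin P
  simp only [LinearMap.comp_apply, AlgHom.toLinearMap_apply, hP, map_zero] at this
  exact Ideal.Quotient.eq_zero_iff_mem.mp this

abbrev Idx (d c : ℕ) : Type := {i : Fin (d + 1) // (i : ℕ) ≠ c}

lemma span_main {K : Type*} [Field K] [IsAlgClosed K] [CharZero K]
    (d c : ℕ) (hc1 : 3 ≤ c) (hc2 : c + 3 ≤ d) (J : Ideal (MvPolynomial (Idx d c) K))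
    (hJ : ∀ q : MvPolynomial (Idx d c) K,
      q ∈ projIdeal K d c → q.IsHomogeneous 2 → rankLE 3 q → q ∈ J) :
    projIdeal K d c ≤ J := by
  classical
  let ev : MvPolynomial (Idx d c) K →ₐ[K] MvPolynomial (Fin 2) K := aeval (fun i : Idx d c =>
      X 0 ^ (d - (i.1 : ℕ)) * X 1 ^ (i.1 : ℕ))
  let x : ℤ → MvPolynomial (Idx d c) K := fun i =>
    if h : i.toNat < d + 1 ∧ i.toNat ≠ c then X ⟨⟨i.toNat, h.1⟩, h.2⟩ else 0
  have hxX : ∀ s : Idx d c, x ((s.1 : ℕ) : ℤ) = X s := by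
    intro s
    have h : (((s.1 : ℕ) : ℤ)).toNat < d + 1 ∧ (((s.1 : ℕ) : ℤ)).toNat ≠ c := by
      have h1 := s.1.2
      have h2 := s.2
      omega
    simp only [x]
    rw [dif_pos h]
    congr 1
  have hevx : ∀ i : ℤ, 0 ≤ i → i ≤ d → i ≠ c → ev (x i) = X 0 ^ (d - i.toNat) * X 1 ^ i.toNat := by
    intro i h0 h1 h2
    have h : i.toNat < d + 1 ∧ i.toNat ≠ c := by omega
    simp only [x, ev]
    rw [dif_pos h, aeval_X]
  have hlin : ∀ i, (x i).IsHomogeneous 1 := by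
    intro i
    simp only [x]
    split_ifs with h
    · exact isHomogeneous_X _ _
    · exact isHomogeneous_zero _ _ _
  have hker : ∀ P, ev P = 0 → P ∈ projIdeal K d c := fun P hP => hP
  have hker' : projIdeal K d c = RingHom.ker ev := rfl
  rw [hker']
  have hevX : ∀ s, ev (X s) = X 0 ^ (d - (s.1 : ℕ)) * X 1 ^ (s.1 : ℕ) := fun s => aeval_X _ _
  clear_value x ev
  clear hker'
  have key : ∀ A B C' : MvPolynomial (Idx d c) K, A.IsHomogeneous 1 → B.IsHomogeneous 1 →
      C'.IsHomogeneous 1 → ev A * ev B = ev C' ^ 2 →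
      Ideal.Quotient.mk J A * Ideal.Quotient.mk J B = Ideal.Quotient.mk J C' ^ 2 := by
    intro A B C' hA hB hC h
    rw [← map_mul, ← map_pow, Ideal.Quotient.eq]
    apply hJ
    · apply hker
      rw [map_sub, map_mul, map_pow, h, sub_self]
    · exact (hA.mul hB).sub (by simpa using hC.pow 2)
    · exact rankLE_mul_sub_sq A B C' hA hB hC
  have hv : (24 : MvPolynomial (Idx d c) K ⧸ J) * Ideal.Quotient.mk J (C (1 / 24 : K)) = 1 := by
    rw [show (24 : MvPolynomial (Idx d c) K ⧸ J) = Ideal.Quotient.mk J (C 24) by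
      rw [show (C (24 : K) : MvPolynomial (Idx d c) K) = 24 from map_ofNat C 24]
      exact (map_ofNat _ 24).symm, ← map_mul, ← C_mul]
    norm_num
  have hg : ∀ i j k l : ℤ, (-(c : ℤ) ≤ i ∧ i ≤ (d : ℤ) - c ∧ i ≠ 0) →
      (-(c : ℤ) ≤ j ∧ j ≤ (d : ℤ) - c ∧ j ≠ 0) →
      (-(c : ℤ) ≤ k ∧ k ≤ (d : ℤ) - c ∧ k ≠ 0) → (-(c : ℤ) ≤ l ∧ l ≤ (d : ℤ) - c ∧ l ≠ 0) →
      i + j = k + l → ev.toRingHom (x (c + i)) * ev.toRingHom (x (c + j))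
        = ev.toRingHom (x (c + k)) * ev.toRingHom (x (c + l)) := by
    intro i j k l hi hj hk hl h
    change ev (x (c + i)) * ev (x (c + j)) = ev (x (c + k)) * ev (x (c + l))
    rw [hevx (c + i) (by omega) (by omega) (by omega), hevx (c + j) (by omega) (by omega) (by omega),
      hevx (c + k) (by omega) (by omega) (by omega), hevx (c + l) (by omega) (by omega) (by omega)]
    have e1 : d - (c + i : ℤ).toNat + (d - (c + j : ℤ).toNat)
      = d - (c + k : ℤ).toNat + (d - (c + l : ℤ).toNat) := by omega
    have e2 : (c + i : ℤ).toNat + (c + j : ℤ).toNat = (c + k : ℤ).toNat + (c + l : ℤ).toNat := by omega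
    rw [mul_mul_mul_comm, ← pow_add, ← pow_add, mul_mul_mul_comm, ← pow_add, ← pow_add, e1, e2]
  have hmul : ∀ (n : ℕ) (a : MvPolynomial (Idx d c) K), a.IsHomogeneous 1 →
      ((n : MvPolynomial (Idx d c) K) * a).IsHomogeneous 1 := by
    intro n a ha
    have := (isHomogeneous_C (Idx d c) (n : K)).mul ha
    rwa [zero_add, map_natCast] at this
  obtain ⟨v, hv'⟩ : ∃ v : MvPolynomial (Idx d c) K ⧸ J, 24 * v = 1 := ⟨_, hv⟩
  have rel0 := rel_of_rank_three (Ideal.Quotient.mk J) ev.toRingHom v hv'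
    (c : ℤ) ((d : ℤ) - c) (by omega) (by omega) (fun i => x (c + i)) (fun L => L.IsHomogeneous 1)
    (fun i => hlin _) (fun a b ha hb => ha.add hb) (fun a b ha hb => ha.sub hb) hmul hg key
  obtain ⟨y, hy⟩ : ∃ y : ℤ → (MvPolynomial (Idx d c) K ⧸ J), ∀ i, y i = Ideal.Quotient.mk J (x i) :=
    ⟨_, fun i => rfl⟩
  have rel : ∀ i j k l : ℤ, (0 ≤ i ∧ i ≤ (d : ℤ) ∧ i ≠ (c : ℤ)) → (0 ≤ j ∧ j ≤ (d : ℤ) ∧ j ≠ (c : ℤ)) →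
      (0 ≤ k ∧ k ≤ (d : ℤ) ∧ k ≠ (c : ℤ)) → (0 ≤ l ∧ l ≤ (d : ℤ) ∧ l ≠ (c : ℤ)) →
      i + j = k + l → y i * y j = y k * y l := by
    intro i j k l hi hj hk hl h
    have := rel0 (i - c) (j - c) (k - c) (l - c) (by omega) (by omega) (by omega) (by omega) (by omega)
    simpa only [add_sub_cancel, ← hy] using this
  obtain ⟨wD, hwD⟩ : ∃ w : (Idx d c →₀ ℕ) →+ ℕ, w = (Finsupp.weight (fun _ : Idx d c => (1 : ℕ))) := ⟨_, rfl⟩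
  obtain ⟨wN, hwN⟩ : ∃ w : (Idx d c →₀ ℕ) →+ ℕ, w = (Finsupp.weight (fun s : Idx d c => (s.1 : ℕ))) := ⟨_, rfl⟩
  obtain ⟨wM, hwM⟩ : ∃ w : (Idx d c →₀ ℕ) →+ ℕ, w = (Finsupp.weight (fun s : Idx d c => d - (s.1 : ℕ))) := ⟨_, rfl⟩
  have wD1 : ∀ s n, wD (Finsupp.single s n) = n := by
    intro s n; simp [hwD, Finsupp.weight_single]
  have wN1 : ∀ s n, wN (Finsupp.single s n) = n * (s.1 : ℕ) := by
    intro s n; simp [hwN, Finsupp.weight_single]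
  have wM1 : ∀ s n, wM (Finsupp.single s n) = n * (d - (s.1 : ℕ)) := by
    intro s n; simp [hwM, Finsupp.weight_single]
  have wsum : ∀ m, wM m + wN m = d * wD m := by
    intro m
    induction m using Finsupp.induction_linear with
    | zero => simp
    | add f g hf hg => simp only [map_add]; linarith
    | single s n =>
      rw [wM1, wN1, wD1, ← mul_add, Nat.sub_add_cancel (by have := s.1.2; omega), mul_comm]
  have hE : ∀ m : Idx d c →₀ ℕ, ev (monomial m 1) =
      monomial (Finsupp.single 0 (wM m) + Finsupp.single 1 (wN m)) 1 := by
    have e1 : ∀ a b : ℕ, (monomial (Finsupp.single (0 : Fin 2) a + Finsupp.single 1 b) (1 : K))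
        = X 0 ^ a * X 1 ^ b := by
      intro a b
      rw [X_pow_eq_monomial, X_pow_eq_monomial, monomial_mul, one_mul]
    intro m
    rw [e1]
    induction m using Finsupp.induction_linear with
    | zero => simp
    | add f g hf hg =>
      rw [show (monomial (f + g) (1 : K)) = monomial f 1 * monomial g 1 by
        rw [monomial_mul, one_mul], map_mul, hf, hg, map_add, map_add]
      ring
    | single s n =>
      rw [← X_pow_eq_monomial, map_pow, wM1, wN1]
      rw [hevX, mul_pow, ← pow_mul, ← pow_mul, mul_comm n, mul_comm n]
  have hNF : ∀ m : Idx d c →₀ ℕ, ∀ D N z, IsNF (d : ℤ) (c : ℤ) y D N z →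
      IsNF (d : ℤ) (c : ℤ) y (D + wD m) (N + wN m) (z * Ideal.Quotient.mk J (monomial m 1)) := by
    intro m
    induction m using Finsupp.induction_linear with
    | zero => intro D N z hz; simpa using hz
    | add f g hf hg =>
      intro D N z hz
      have := hg _ _ _ (hf _ _ _ hz)
      rw [mul_assoc, ← map_mul, monomial_mul, one_mul, add_assoc, add_assoc, ← map_add, ← map_add] at this
      exact this
    | single s n =>
      intro D N z hz
      rw [← X_pow_eq_monomial, wD1, wN1]
      induction n with
      | zero => simpa using hz
      | succ n ih =>
        have := IsNF.mul (d : ℤ) (c : ℤ) (by omega) (by omega) y rel _ _ _ (s.1 : ℕ)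
          (by have := s.1.2; have := s.2; omega) ih
        have e : y (((s.1 : ℕ) : ℤ)) = Ideal.Quotient.mk J (X s) := by
          simp only [hy, hxX]
        rw [e, mul_assoc, ← map_mul, ← pow_succ] at this
        convert this using 1
        all_goals ring
  refine ker_le_of_monomials ev (fun m => Finsupp.single 0 (wM m) + Finsupp.single 1 (wN m)) hE J ?_
  intro m m' h
  have h0 : wM m = wM m' := by simpa using DFunLike.congr_fun h 0
  have h1 : wN m = wN m' := by simpa using DFunLike.congr_fun h 1
  have h2 : wD m = wD m' := by
    have a1 := wsum m
    have a2 := wsum m'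
    rw [h0, h1, a2] at a1
    exact (Nat.eq_of_mul_eq_mul_left (by omega) a1).symm
  have n1 := hNF m 0 0 1 (Or.inl ⟨rfl, rfl, rfl⟩)
  have n2 := hNF m' 0 0 1 (Or.inl ⟨rfl, rfl, rfl⟩)
  rw [h1, h2] at n1
  have := IsNF.unique (d : ℤ) (c : ℤ) (by omega) (by omega) y rel _ _ _ _ n1 n2
  simpa using this

theorem stmt4 {K : Type*} [Field K] [IsAlgClosed K] [CharZero K]
    (d c : ℕ) (hd : 6 ≤ d) (hc1 : 3 ≤ c) (hc2 : c ≤ d - 3) :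
    projIdeal K d c
      = Ideal.span {q : MvPolynomial {i : Fin (d + 1) // (i : ℕ) ≠ c} K |
          q ∈ projIdeal K d c ∧ q.IsHomogeneous 2 ∧ rankLE 3 q} := by
  apply le_antisymm
  · exact span_main d c hc1 (by omega) _
      (fun q h1 h2 h3 => Ideal.subset_span ⟨h1, h2, h3⟩)
  · rw [Ideal.span_le]
    intro q hq
    exact hq.1
end

section
/- Let d ≥ 4 and 0 ≤ c ≤ d be integers, and let i, j, k be integers with 0 ≤ i < j ≤ d, k ≥ 0, i < j − k, i + j + k even, and c ∉ {i, i+k, j−k, j, (i+j−k)/2, (i+j+k)/2}. Then the quadratic binomial x_i x_j + x_{i+k} x_{j−k} − 2 x_{(i+j−k)/2} x_{(i+j+k)/2} lies in the K-linear span of the homogeneous quadratic polynomials of rank at most 3 contained in the degree-2 component (I_{d,c})₂. -/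
open MvPolynomial

theorem aux_rank {K : Type*} [Field K] [IsAlgClosed K] [CharZero K] {σ : Type*}
    (A B C : MvPolynomial σ K) (hA : A.IsHomogeneous 1) (hB : B.IsHomogeneous 1)
    (hC : C.IsHomogeneous 1) : rankLE 3 (A * B - C ^ 2) := by
  obtain ⟨z, hz⟩ := IsAlgClosed.exists_pow_nat_eq (-1 : K) (n := 2) (by norm_num)
  have hI : (MvPolynomial.C z : MvPolynomial σ K) ^ 2 = -1 := by
    rw [← map_pow, hz]; simp
  have hh : (MvPolynomial.C (1 / 2 : K) : MvPolynomial σ K) * 2 = 1 := by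
    have : (2 : MvPolynomial σ K) = MvPolynomial.C (2 : K) := (map_ofNat _ 2).symm
    rw [this, ← map_mul]; norm_num
  refine ⟨![MvPolynomial.C (1 / 2 : K) * (A + B),
    MvPolynomial.C (z * (1 / 2) : K) * (A - B), MvPolynomial.C z * C], ?_, ?_⟩
  · intro i
    fin_cases i
    · exact (hA.add hB).C_mul _
    · exact (hA.sub hB).C_mul _
    · exact hC.C_mul _
  · simp only [Fin.sum_univ_three, Matrix.cons_val_zero, Matrix.cons_val_one, Matrix.cons_val,
      map_mul, mul_pow, hI]
    generalize (MvPolynomial.C (1 / 2 : K) : MvPolynomial σ K) = h at hh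
    linear_combination (-(A * B) * (h * 2 + 1)) * hh

theorem aux_mem {K : Type*} [Field K] [IsAlgClosed K] [CharZero K]
    (d c a k m b e f g h : ℕ) (hb : b = a + k) (he : e = a + m) (hf : f = a + m + k)
    (hg : g = a + 2 * m) (hh : h = a + 2 * m + k)
    (a1 : a < d + 1) (b1 : b < d + 1) (e1 : e < d + 1) (f1 : f < d + 1) (g1 : g < d + 1)
    (h1 : h < d + 1) (a2 : a ≠ c) (b2 : b ≠ c) (e2 : e ≠ c) (f2 : f ≠ c) (g2 : g ≠ c)
    (h2 : h ≠ c) (l : K) :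
    (xVar K d c a a1 a2 + MvPolynomial.C l * xVar K d c b b1 b2)
      * (xVar K d c g g1 g2 + MvPolynomial.C l * xVar K d c h h1 h2)
      - (xVar K d c e e1 e2 + MvPolynomial.C l * xVar K d c f f1 f2) ^ 2
      ∈ {q : MvPolynomial {m : Fin (d + 1) // (m : ℕ) ≠ c} K |
          q ∈ projIdeal K d c ∧ q.IsHomogeneous 2 ∧ rankLE 3 q} := by
  have hx : ∀ n n1 n2, (xVar K d c n n1 n2).IsHomogeneous 1 := fun _ _ _ => isHomogeneous_X _ _
  have hA := (hx a a1 a2).add ((hx b b1 b2).C_mul l)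
  have hB := (hx g g1 g2).add ((hx h h1 h2).C_mul l)
  have hC := (hx e e1 e2).add ((hx f f1 f2).C_mul l)
  refine ⟨?_, (hA.mul hB).sub (hC.pow 2), aux_rank _ _ _ hA hB hC⟩
  obtain ⟨r, rfl⟩ : ∃ r, d = a + 2 * m + k + r := ⟨d - (a + 2 * m + k), by omega⟩
  subst hb he hf hg hh
  rw [projIdeal, RingHom.mem_ker]
  simp only [xVar, map_sub, map_mul, map_add, map_pow, aeval_X, algHom_C]
  rw [show a + 2 * m + k + r - a = 2 * m + k + r by omega,
    show a + 2 * m + k + r - (a + k) = 2 * m + r by omega,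
    show a + 2 * m + k + r - (a + m) = m + k + r by omega,
    show a + 2 * m + k + r - (a + m + k) = m + r by omega,
    show a + 2 * m + k + r - (a + 2 * m) = k + r by omega,
    show a + 2 * m + k + r - (a + 2 * m + k) = r by omega]
  ring

theorem stmt5 {K : Type*} [Field K] [IsAlgClosed K] [CharZero K]
    (d c i j k : ℕ) (hd : 4 ≤ d) (hcd : c ≤ d)
    (hij : i < j) (hjd : j ≤ d) (hik : i < j - k)
    (heven : (i + j + k) % 2 = 0)
    (hc1 : c ≠ i) (hc2 : c ≠ i + k) (hc3 : c ≠ j - k) (hc4 : c ≠ j)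
    (hc5 : c ≠ (i + j - k) / 2) (hc6 : c ≠ (i + j + k) / 2) :
    xVar K d c i (by omega) (by omega) * xVar K d c j (by omega) (by omega)
      + xVar K d c (i + k) (by omega) (by omega) * xVar K d c (j - k) (by omega) (by omega)
      - 2 * (xVar K d c ((i + j - k) / 2) (by omega) (by omega)
          * xVar K d c ((i + j + k) / 2) (by omega) (by omega))
      ∈ Submodule.span K {q : MvPolynomial {m : Fin (d + 1) // (m : ℕ) ≠ c} K |
          q ∈ projIdeal K d c ∧ q.IsHomogeneous 2 ∧ rankLE 3 q} := by
  have key := aux_mem (K := K) d c i k ((j - k - i) / 2) (i + k) ((i + j - k) / 2)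
    ((i + j + k) / 2) (j - k) j rfl (by omega) (by omega) (by omega) (by omega)
    (by omega) (by omega) (by omega) (by omega) (by omega) (by omega)
    (by omega) (by omega) (by omega) (by omega) (by omega) (by omega)
  have k1 := Submodule.smul_mem _ (1 / 2 : K) (Submodule.sub_mem _
    (Submodule.subset_span (R := K) (key 1)) (Submodule.subset_span (R := K) (key (-1))))
  convert k1 using 1
  have hh : (MvPolynomial.C (1 / 2 : K) :
      MvPolynomial {m : Fin (d + 1) // (m : ℕ) ≠ c} K) * 2 = 1 := by
    have : (2 : MvPolynomial {m : Fin (d + 1) // (m : ℕ) ≠ c} K)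
      = MvPolynomial.C (2 : K) := (map_ofNat _ 2).symm
    rw [this, ← map_mul]; norm_num
  rw [MvPolynomial.smul_eq_C_mul, map_neg, map_one]
  generalize (MvPolynomial.C (1 / 2 : K) :
      MvPolynomial {m : Fin (d + 1) // (m : ℕ) ≠ c} K) = h at hh
  generalize xVar K d c i _ _ = y1
  generalize xVar K d c j _ _ = y2
  generalize xVar K d c (i + k) _ _ = y3
  generalize xVar K d c (j - k) _ _ = y4
  generalize xVar K d c ((i + j - k) / 2) _ _ = y5
  generalize xVar K d c ((i + j + k) / 2) _ _ = y6
  linear_combination (-(y1 * y2 + y3 * y4 - 2 * (y5 * y6))) * hh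
end

section
/- Let d ≥ 5 and let V ⊆ (I_{d,2})₂ be the K-linear span of the homogeneous quadratic polynomials of rank at most 3 contained in (I_{d,2})₂. Then V has codimension exactly 2 in (I_{d,2})₂, i.e., dim_K (I_{d,2})₂ − dim_K V = 2. In particular, the ideal of K[x₀,x₁,x₃,…,x_d] generated by (I_{d,2})₂ (the homogeneous ideal of the scheme X_d = C_{d,2} ∪ L, the union of the projected curve C_{d,2} with its trisecant line L) is not generated by quadratic polynomials of rank at most 3; that is, X_d does not satisfy property QR(3). -/
open MvPolynomial

/-- The degree-2 homogeneous component `(I_{d,c})₂` as a `K`-subspace. -/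
noncomputable def quadComp (K : Type*) [Field K] (d c : ℕ) :
    Submodule K (MvPolynomial {i : Fin (d + 1) // (i : ℕ) ≠ c} K) :=
  (projIdeal K d c).restrictScalars K ⊓ homogeneousSubmodule _ K 2

namespace QR

/-- index type -/
abbrev Sg (d : ℕ) := {m : Fin (d + 1) // (m : ℕ) ≠ 2}

/-- the generating set of rank at most three quadrics -/
def GS (K : Type*) [Field K] (d : ℕ) : Set (MvPolynomial (Sg d) K) :=
  {q | q ∈ projIdeal K d 2 ∧ q.IsHomogeneous 2 ∧ rankLE 3 q}

/-- their span -/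
noncomputable def VV (K : Type*) [Field K] (d : ℕ) : Submodule K (MvPolynomial (Sg d) K) :=
  Submodule.span K (GS K d)

/-- total version of the variables -/
noncomputable def xx (K : Type*) [Field K] (d m : ℕ) : MvPolynomial (Sg d) K :=
  if h : m < d + 1 ∧ m ≠ 2 then X ⟨⟨m, h.1⟩, h.2⟩ else 0

/-- the defining map -/
noncomputable def ph (K : Type*) [Field K] (d : ℕ) :
    MvPolynomial (Sg d) K →ₐ[K] MvPolynomial (Fin 2) K :=
  aeval (fun i : Sg d => X 0 ^ (d - (i.1 : ℕ)) * X 1 ^ (i.1 : ℕ))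

/-- dehomogenized map -/
noncomputable def ps (K : Type*) [Field K] (d : ℕ) :
    MvPolynomial (Sg d) K →ₐ[K] Polynomial K :=
  aeval (fun i : Sg d => Polynomial.X ^ (i.1 : ℕ))

section
variable {K : Type*} [Field K] {d : ℕ}

lemma mem_iff (q : MvPolynomial (Sg d) K) : q ∈ projIdeal K d 2 ↔ ph K d q = 0 := by
  rfl

lemma ps_of_mem {q : MvPolynomial (Sg d) K} (h : q ∈ projIdeal K d 2) : ps K d q = 0 := by
  have e : ps K d = (aeval (fun i : Fin 2 => if i = 0 then (1 : Polynomial K)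
      else Polynomial.X)).comp (ph K d) := by
    apply MvPolynomial.algHom_ext
    intro i
    simp [ps, ph]
  rw [e, AlgHom.comp_apply, (mem_iff q).1 h, map_zero]

lemma hom_xx (m : ℕ) : (xx K d m).IsHomogeneous 1 := by
  unfold xx
  split_ifs
  · exact isHomogeneous_X _ _
  · exact isHomogeneous_zero _ _ _

lemma ph_mul {a b w : ℕ} (h : a + b = w) (ha : a ≤ d ∧ a ≠ 2) (hb : b ≤ d ∧ b ≠ 2) :
    ph K d (xx K d a * xx K d b) = X 0 ^ (2 * d - w) * X 1 ^ w := by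
  subst h
  have ha' : a < d + 1 ∧ a ≠ 2 := ⟨by omega, ha.2⟩
  have hb' : b < d + 1 ∧ b ≠ 2 := ⟨by omega, hb.2⟩
  simp only [xx, dif_pos ha', dif_pos hb', map_mul, ph, aeval_X]
  have : 2 * d - (a + b) = (d - a) + (d - b) := by omega
  rw [this]; ring

lemma ps_mul {a b w : ℕ} (h : a + b = w) (ha : a ≤ d ∧ a ≠ 2) (hb : b ≤ d ∧ b ≠ 2) :
    ps K d (xx K d a * xx K d b) = Polynomial.X ^ w := by
  subst h
  have ha' : a < d + 1 ∧ a ≠ 2 := ⟨by omega, ha.2⟩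
  have hb' : b < d + 1 ∧ b ≠ 2 := ⟨by omega, hb.2⟩
  simp only [xx, dif_pos ha', dif_pos hb', map_mul, ps, aeval_X]
  ring

lemma VV_le : VV K d ≤ quadComp K d 2 := by
  refine Submodule.span_le.2 ?_
  rintro q ⟨h1, h2, -⟩
  exact ⟨h1, h2⟩

lemma mem_VV [IsAlgClosed K] [CharZero K] {y z w : MvPolynomial (Sg d) K}
    (hy : y.IsHomogeneous 1) (hz : z.IsHomogeneous 1) (hw : w.IsHomogeneous 1)
    (h : ph K d (y * z - w ^ 2) = 0) : y * z - w ^ 2 ∈ VV K d := by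
  apply Submodule.subset_span
  refine ⟨h, (hy.mul hz).sub (hw.pow 2), ?_⟩
  obtain ⟨i, hi⟩ := IsAlgClosed.exists_pow_nat_eq (-1 : K) (n := 2) (by norm_num)
  refine ⟨![C (1/2) * (y + z), C (i/2) * (y - z), C i * w], ?_, ?_⟩
  · intro j
    fin_cases j
    · exact (hy.add hz).C_mul _
    · exact (hy.sub hz).C_mul _
    · exact hw.C_mul _
  · simp only [Fin.sum_univ_three, Matrix.cons_val_zero, Matrix.cons_val_one, Matrix.cons_val]
    have h1 : (C (1/2) : MvPolynomial (Sg d) K) * 2 = 1 := by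
      rw [show (2 : MvPolynomial (Sg d) K) = C 2 from (map_ofNat C 2).symm, ← C_mul]; simp
    have h2 : (C (i/2) : MvPolynomial (Sg d) K) = C i * C (1/2) := by
      rw [← C_mul]; congr 1; ring
    have h3 : (C i : MvPolynomial (Sg d) K) ^ 2 = -1 := by
      rw [← C_pow, hi]; simp
    rw [h2]
    generalize (C (1/2) : MvPolynomial (Sg d) K) = u at *
    generalize (C i : MvPolynomial (Sg d) K) = v at *
    have h4 : u ^ 2 * 4 = 1 := by linear_combination (2 * u + 1) * h1
    linear_combination (-y*z) * h4 - (u^2*(y-z)^2 + w^2) * h3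

variable [IsAlgClosed K] [CharZero K]

lemma F0 {i j k : ℕ} (h : i + j = 2 * k) (hi : i ≤ d ∧ i ≠ 2) (hj : j ≤ d ∧ j ≠ 2)
    (hk : k ≤ d ∧ k ≠ 2) : xx K d i * xx K d j - xx K d k * xx K d k ∈ VV K d := by
  rw [← sq]
  apply mem_VV (hom_xx _) (hom_xx _) (hom_xx _)
  rw [sq, map_sub, ph_mul h hi hj, ph_mul (by omega : k + k = 2 * k) hk hk, sub_self]

lemma F1 {p r s n u v : ℕ} (hn : 2 * n = r + s) (hu : 2 * u = p + r) (hv : 2 * v = p + s)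
    (hp' : p ≤ d ∧ p ≠ 2) (hr' : r ≤ d ∧ r ≠ 2) (hs' : s ≤ d ∧ s ≠ 2) (hn' : n ≠ 2)
    (hu' : u ≠ 2) (hv' : v ≠ 2) :
    xx K d p * xx K d n - xx K d u * xx K d v ∈ VV K d := by
  have n' : n ≤ d ∧ n ≠ 2 := ⟨by omega, hn'⟩
  have u' : u ≤ d ∧ u ≠ 2 := ⟨by omega, hu'⟩
  have v' : v ≤ d ∧ v ≠ 2 := ⟨by omega, hv'⟩
  have k1 : xx K d p * xx K d r - xx K d u * xx K d u ∈ VV K d := F0 hu.symm hp' hr' u'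
  have k2 : xx K d p * xx K d s - xx K d v * xx K d v ∈ VV K d := F0 hv.symm hp' hs' v'
  have k3 : xx K d p * (xx K d r + (xx K d n + xx K d n) + xx K d s) - (xx K d u + xx K d v) ^ 2
      ∈ VV K d := by
    apply mem_VV (hom_xx _) (((hom_xx _).add ((hom_xx _).add (hom_xx _))).add (hom_xx _))
      ((hom_xx _).add (hom_xx _))
    have e : xx K d p * (xx K d r + (xx K d n + xx K d n) + xx K d s) - (xx K d u + xx K d v) ^ 2
      = xx K d p * xx K d r + (xx K d p * xx K d n + xx K d p * xx K d n) + xx K d p * xx K d s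
        - (xx K d u * xx K d u + (xx K d u * xx K d v + xx K d u * xx K d v)
        + xx K d v * xx K d v) := by ring
    rw [e]
    simp only [map_add, map_sub]
    rw [ph_mul hu.symm hp' hr', ph_mul hv.symm hp' hs', ph_mul rfl hp' n',
      ph_mul (by omega : u + v = p + n) u' v', ph_mul (by omega : u + u = 2 * u) u' u',
      ph_mul (by omega : v + v = 2 * v) v' v']
    ring
  have := (VV K d).smul_mem (1/2 : K) ((VV K d).sub_mem ((VV K d).sub_mem k3 k1) k2)
  convert this using 1
  rw [smul_eq_C_mul]
  have h1 : (C (1/2) : MvPolynomial (Sg d) K) * 2 = 1 := by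
    rw [show (2 : MvPolynomial (Sg d) K) = C 2 from (map_ofNat C 2).symm, ← C_mul]; simp
  linear_combination (-(xx K d p * xx K d n - xx K d u * xx K d v)) * h1

lemma F2 {p u q p' v q' : ℕ} (h1 : p + q = 2 * u) (h2 : p' + q' = 2 * v) (h3 : p + q' = u + v)
    (h4 : p' + q = u + v) (ip : p ≤ d ∧ p ≠ 2) (iq : q ≤ d ∧ q ≠ 2)
    (ip' : p' ≤ d ∧ p' ≠ 2) (iq' : q' ≤ d ∧ q' ≠ 2) (hu' : u ≠ 2) (hv' : v ≠ 2) :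
    xx K d p * xx K d q' + xx K d p' * xx K d q - (xx K d u * xx K d v + xx K d u * xx K d v)
      ∈ VV K d := by
  have u' : u ≤ d ∧ u ≠ 2 := ⟨by omega, hu'⟩
  have v' : v ≤ d ∧ v ≠ 2 := ⟨by omega, hv'⟩
  have k1 : xx K d p * xx K d q - xx K d u * xx K d u ∈ VV K d := F0 h1 ip iq u'
  have k2 : xx K d p' * xx K d q' - xx K d v * xx K d v ∈ VV K d := F0 h2 ip' iq' v'
  have k3 : (xx K d p + xx K d p') * (xx K d q + xx K d q') - (xx K d u + xx K d v) ^ 2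
      ∈ VV K d := by
    apply mem_VV ((hom_xx _).add (hom_xx _)) ((hom_xx _).add (hom_xx _))
      ((hom_xx _).add (hom_xx _))
    have e : (xx K d p + xx K d p') * (xx K d q + xx K d q') - (xx K d u + xx K d v) ^ 2
      = xx K d p * xx K d q + xx K d p * xx K d q' + xx K d p' * xx K d q + xx K d p' * xx K d q'
        - (xx K d u * xx K d u + (xx K d u * xx K d v + xx K d u * xx K d v)
        + xx K d v * xx K d v) := by ring
    rw [e]
    simp only [map_add, map_sub]
    rw [ph_mul h1 ip iq, ph_mul h2 ip' iq', ph_mul h3 ip iq', ph_mul h4 ip' iq,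
      ph_mul rfl u' v', ph_mul (by omega : u + u = 2 * u) u' u',
      ph_mul (by omega : v + v = 2 * v) v' v']
    ring
  have := (VV K d).sub_mem ((VV K d).sub_mem k3 k1) k2
  convert this using 1
  ring

/-- middle representative, odd weight `2k+1`, easy cases -/
lemma odd_easy {i j k : ℕ} (hk : 3 ≤ k) (h : i + j = 2 * k + 1) (hi : i ≤ k ∧ i ≠ 2)
    (hj : j + 1 ≤ d) : xx K d i * xx K d j - xx K d k * xx K d (k + 1) ∈ VV K d := by
  apply F1 (p := i) (r := j - 1) (s := j + 1) <;> omega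

lemma odd_d_big {i k : ℕ} (hk : 3 ≤ k) (h : i + d = 2 * k + 1) (hi : i ≤ k ∧ 4 ≤ i) :
    xx K d i * xx K d d - xx K d k * xx K d (k + 1) ∈ VV K d := by
  rw [mul_comm (xx K d i)]
  apply F1 (p := d) (r := i - 1) (s := i + 1) <;> omega

lemma odd_d_zero {k : ℕ} (hk : 3 ≤ k) (h : d = 2 * k + 1) :
    xx K d 0 * xx K d d - xx K d k * xx K d (k + 1) ∈ VV K d := by
  have a : xx K d 0 * xx K d d + xx K d 1 * xx K d (d - 1) -
    (xx K d k * xx K d (k + 1) + xx K d k * xx K d (k + 1)) ∈ VV K d := by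
    apply F2 <;> omega
  have b : xx K d 1 * xx K d (d - 1) - xx K d k * xx K d (k + 1) ∈ VV K d := by
    apply odd_easy <;> omega
  convert (VV K d).sub_mem a b using 1
  ring

lemma odd_d_three {k : ℕ} (hd : 6 ≤ d) (h : 3 + d = 2 * k + 1) :
    xx K d 3 * xx K d d - xx K d k * xx K d (k + 1) ∈ VV K d := by
  have a : xx K d 3 * xx K d d + xx K d 4 * xx K d (d - 1) -
    (xx K d k * xx K d (k + 1) + xx K d k * xx K d (k + 1)) ∈ VV K d := by
    apply F2 <;> omega
  have b : xx K d 4 * xx K d (d - 1) - xx K d k * xx K d (k + 1) ∈ VV K d := by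
    by_cases h4 : 4 ≤ k
    · apply odd_easy <;> omega
    · omega
  convert (VV K d).sub_mem a b using 1
  ring

lemma odd_d_one_big {k : ℕ} (hd : 8 ≤ d) (h : 1 + d = 2 * k + 1) :
    xx K d 1 * xx K d d - xx K d k * xx K d (k + 1) ∈ VV K d := by
  have a : xx K d 1 * xx K d d + xx K d 4 * xx K d (d - 3) -
    (xx K d (k - 1) * xx K d (k + 2) + xx K d (k - 1) * xx K d (k + 2)) ∈ VV K d := by
    apply F2 <;> omega
  have b : xx K d 4 * xx K d (d - 3) - xx K d k * xx K d (k + 1) ∈ VV K d := by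
    apply odd_easy <;> omega
  have c : xx K d (k - 1) * xx K d (k + 2) - xx K d k * xx K d (k + 1) ∈ VV K d := by
    apply odd_easy <;> omega
  convert (VV K d).add_mem (VV K d |>.sub_mem a b) ((VV K d).add_mem c c) using 1
  ring

lemma odd_d_one_six : xx K 6 1 * xx K 6 6 - xx K 6 3 * xx K 6 4 ∈ VV K 6 := by
  have a : xx K 6 6 * (xx K 6 0 + C 4 * xx K 6 1 + C (-8) * xx K 6 3 + C 4 * xx K 6 4)
      - (xx K 6 3 + C 2 * xx K 6 4 + C (-2) * xx K 6 5) ^ 2 ∈ VV K 6 := by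
    apply mem_VV (hom_xx _) ((((hom_xx _).add ((hom_xx _).C_mul _)).add ((hom_xx _).C_mul _)).add
      ((hom_xx _).C_mul _)) (((hom_xx _).add ((hom_xx _).C_mul _)).add ((hom_xx _).C_mul _))
    simp only [xx, ph]
    simp
    simp only [map_ofNat C]
    ring
  have b1 : xx K 6 0 * xx K 6 6 - xx K 6 3 * xx K 6 3 ∈ VV K 6 := by apply F0 <;> omega
  have b2 : xx K 6 3 * xx K 6 6 - xx K 6 4 * xx K 6 5 ∈ VV K 6 := by
    apply odd_d_three <;> omega
  have b3 : xx K 6 3 * xx K 6 5 - xx K 6 4 * xx K 6 4 ∈ VV K 6 := by apply F0 <;> omega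
  have b4 : xx K 6 4 * xx K 6 6 - xx K 6 5 * xx K 6 5 ∈ VV K 6 := by apply F0 <;> omega
  have := (VV K 6).smul_mem (1/4 : K) ((VV K 6).sub_mem ((VV K 6).sub_mem ((VV K 6).add_mem
    ((VV K 6).sub_mem a b1) ((VV K 6).smul_mem (8 : K) b2)) ((VV K 6).smul_mem (4 : K) b3))
    ((VV K 6).smul_mem (4 : K) b4))
  convert this using 1
  simp only [smul_eq_C_mul]
  have h1 : (C (1/4) : MvPolynomial (Sg 6) K) * 4 = 1 := by
    rw [show (4 : MvPolynomial (Sg 6) K) = C 4 from (map_ofNat C 4).symm, ← C_mul]; simp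
  simp only [map_neg, show (C 4 : MvPolynomial (Sg 6) K) = 4 from map_ofNat C 4,
    show (C 8 : MvPolynomial (Sg 6) K) = 8 from map_ofNat C 8, show (C 2 : MvPolynomial (Sg 6) K) = 2 from map_ofNat C 2]
  linear_combination (-(xx K 6 1 * xx K 6 6 - xx K 6 3 * xx K 6 4)) * h1

lemma odd_all {i j k : ℕ} (hk : 3 ≤ k) (h : i + j = 2 * k + 1) (hi : i ≤ k ∧ i ≠ 2)
    (hj : j ≤ d) : xx K d i * xx K d j - xx K d k * xx K d (k + 1) ∈ VV K d := by
  rcases Nat.lt_or_ge j d with hjd | hjd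
  · exact odd_easy hk h hi hjd
  obtain rfl : j = d := by omega
  rcases Nat.lt_or_ge i 4 with h4 | h4
  · interval_cases i
    · exact odd_d_zero hk (by omega)
    · by_cases h8 : 8 ≤ j
      · exact odd_d_one_big h8 h
      · obtain rfl : j = 6 := by omega
        obtain rfl : k = 3 := by omega
        exact odd_d_one_six
    · omega
    · by_cases h6 : 6 ≤ j
      · exact odd_d_three h6 h
      · obtain rfl : j = 4 := by omega
        obtain rfl : k = 3 := by omega
        simp
  · exact odd_d_big hk h ⟨hi.1, h4⟩

/-- representative in each weight -/
noncomputable def RR (K : Type*) [Field K] (d w : ℕ) : MvPolynomial (Sg d) K :=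
  if w = 0 then xx K d 0 * xx K d 0
  else if w = 1 then xx K d 0 * xx K d 1
  else if w = 2 then xx K d 1 * xx K d 1
  else if w = 3 then xx K d 0 * xx K d 3
  else if w = 4 then xx K d 1 * xx K d 3
  else if w = 5 then xx K d 1 * xx K d 4
  else xx K d (w / 2) * xx K d ((w + 1) / 2)

/-- big space -/
noncomputable def WW (K : Type*) [Field K] (d : ℕ) : Submodule K (MvPolynomial (Sg d) K) :=
  VV K d ⊔ Submodule.span K {xx K d 0 * xx K d 4 - xx K d 1 * xx K d 3,
    xx K d 0 * xx K d 5 - xx K d 1 * xx K d 4}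

lemma VV_le_WW : VV K d ≤ WW K d := le_sup_left

lemma red_le {i j : ℕ} (hij : i ≤ j) (hi : i ≠ 2) (hj : j ≤ d ∧ j ≠ 2) :
    xx K d i * xx K d j - RR K d (i + j) ∈ WW K d := by
  rcases Nat.lt_or_ge (i + j) 6 with h | h
  · have hj5 : j < 6 := by omega
    have hi5 : i < 4 := by omega
    have e1 : xx K d 0 * xx K d 4 - xx K d 1 * xx K d 3 ∈ WW K d :=
      Submodule.mem_sup_right (Submodule.subset_span (by simp))
    have e2 : xx K d 0 * xx K d 5 - xx K d 1 * xx K d 4 ∈ WW K d :=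
      Submodule.mem_sup_right (Submodule.subset_span (by simp))
    interval_cases i <;> interval_cases j <;> first | omega | (simp [RR]; try assumption)
  · apply VV_le_WW
    have hR : RR K d (i + j) = xx K d ((i + j) / 2) * xx K d ((i + j + 1) / 2) := by
      unfold RR
      rw [if_neg (by omega), if_neg (by omega), if_neg (by omega), if_neg (by omega),
        if_neg (by omega), if_neg (by omega)]
    rw [hR]
    rcases Nat.even_or_odd' (i + j) with ⟨k, hk | hk⟩
    · have a1 : (i + j) / 2 = k := by omega
      have a2 : (i + j + 1) / 2 = k := by omega
      rw [a1, a2]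
      apply F0 hk <;> omega
    · have a1 : (i + j) / 2 = k := by omega
      have a2 : (i + j + 1) / 2 = k + 1 := by omega
      rw [a1, a2]
      apply odd_all <;> omega

lemma red {i j : ℕ} (hi : i ≤ d ∧ i ≠ 2) (hj : j ≤ d ∧ j ≠ 2) :
    xx K d i * xx K d j - RR K d (i + j) ∈ WW K d := by
  rcases le_total i j with h | h
  · exact red_le h hi.2 hj
  · rw [mul_comm, add_comm i j]
    exact red_le h hj.2 hi

/-- the linear section -/
noncomputable def TT (K : Type*) [Field K] (d : ℕ) :
    Polynomial K →ₗ[K] MvPolynomial (Sg d) K :=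
  (Polynomial.basisMonomials K).constr K (RR K d)

lemma TT_X (w : ℕ) : TT K d (Polynomial.X ^ w) = RR K d w := by
  have := (Polynomial.basisMonomials K).constr_basis K (RR K d) w
  simpa [TT, Polynomial.coe_basisMonomials, Polynomial.monomial_one_right_eq_X_pow] using this

lemma X_eq (i : Sg d) : (X i : MvPolynomial (Sg d) K) = xx K d (i.1 : ℕ) := by
  rw [xx, dif_pos ⟨i.1.2, i.2⟩]

lemma quad_le : quadComp K d 2 ≤ WW K d := by
  have key : homogeneousSubmodule (Sg d) K 2 ≤
      (WW K d).comap (LinearMap.id - (TT K d).comp (ps K d).toLinearMap) := by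
    rw [← homogeneousSubmodule_one_pow, homogeneousSubmodule_one_eq_span_X, sq,
      Submodule.span_mul_span, Submodule.span_le]
    rintro _ ⟨_, ⟨i, rfl⟩, _, ⟨j, rfl⟩, rfl⟩
    have hi : (i.1 : ℕ) ≤ d ∧ (i.1 : ℕ) ≠ 2 := ⟨by omega, i.2⟩
    have hj : (j.1 : ℕ) ≤ d ∧ (j.1 : ℕ) ≠ 2 := ⟨by omega, j.2⟩
    simp only [SetLike.mem_coe, Submodule.mem_comap, LinearMap.sub_apply, LinearMap.id_apply,
      LinearMap.comp_apply, AlgHom.toLinearMap_apply, X_eq]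
    rw [ps_mul rfl hi hj, TT_X]
    exact red hi hj
  rintro q ⟨h1, h2⟩
  have := key h2
  simpa [ps_of_mem h1] using this

end

section
variable {K : Type*} [Field K] {d : ℕ}

/-- first order coefficient -/
noncomputable def cc (a : Sg d) : MvPolynomial (Sg d) K →ₗ[K] K :=
  (aeval (fun _ : Sg d => (0 : K))).toLinearMap.comp (pderiv a : Derivation K _ _).toLinearMap

/-- second order coefficient -/
noncomputable def DD (a b : Sg d) : MvPolynomial (Sg d) K →ₗ[K] K :=
  (cc a).comp (pderiv b : Derivation K _ _).toLinearMap

/-- constant coefficient -/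
noncomputable def c0 : MvPolynomial (Sg d) K →ₐ[K] K := aeval (fun _ : Sg d => (0 : K))

lemma cc_apply (a : Sg d) (q : MvPolynomial (Sg d) K) : cc a q = c0 (pderiv a q) := rfl

lemma DD_apply (a b : Sg d) (q : MvPolynomial (Sg d) K) :
    DD a b q = c0 (pderiv a (pderiv b q)) := rfl

lemma lin_c0 {l : MvPolynomial (Sg d) K} (h : l.IsHomogeneous 1) : c0 l = 0 := by
  have : homogeneousSubmodule (Sg d) K 1 ≤ LinearMap.ker (c0 (K := K) (d := d)).toLinearMap := by
    rw [homogeneousSubmodule_one_eq_span_X, Submodule.span_le]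
    rintro _ ⟨i, rfl⟩
    simp [c0]
  exact this h

lemma lin_ps {l : MvPolynomial (Sg d) K} (h : l.IsHomogeneous 1) (a : Sg d) :
    cc a l = (ps K d l).coeff (a.1 : ℕ) := by
  have : homogeneousSubmodule (Sg d) K 1 ≤ LinearMap.ker
      (cc a - (Polynomial.lcoeff K (a.1 : ℕ)).comp (ps K d).toLinearMap) := by
    classical
    rw [homogeneousSubmodule_one_eq_span_X, Submodule.span_le]
    rintro _ ⟨i, rfl⟩
    simp [cc, ps, pderiv_X, Polynomial.coeff_X_pow, Pi.single_apply, Subtype.ext_iff, Fin.ext_iff]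
    split_ifs <;> simp
    all_goals omega
  exact sub_eq_zero.1 (by simpa using this h)

lemma lin_ps2 {l : MvPolynomial (Sg d) K} (h : l.IsHomogeneous 1) :
    (ps K d l).coeff 2 = 0 := by
  have : homogeneousSubmodule (Sg d) K 1 ≤ LinearMap.ker
      ((Polynomial.lcoeff K 2).comp (ps K d).toLinearMap) := by
    rw [homogeneousSubmodule_one_eq_span_X, Submodule.span_le]
    rintro _ ⟨i, rfl⟩
    simp [ps, Polynomial.coeff_X_pow]
    exact fun h => i.2 h.symm
  simpa using this h

lemma DD_sq {l : MvPolynomial (Sg d) K} (h : l.IsHomogeneous 1) (a b : Sg d) :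
    DD a b (l ^ 2) = 2 * ((ps K d l).coeff (a.1 : ℕ) * (ps K d l).coeff (b.1 : ℕ)) := by
  rw [DD_apply, ← lin_ps h, ← lin_ps h, cc_apply, cc_apply, sq]
  simp only [pderiv_mul, map_add, map_mul, lin_c0 h]
  ring

/-- isotropic vectors in three-space -/
lemma iso_aux {a b c x y z : K} (ha : a ≠ 0) (h0 : a * a + b * b + c * c = 0)
    (h1 : a * x + b * y + c * z = 0) (h2 : x * x + y * y + z * z = 0) :
    ∃ t, x = t * a ∧ y = t * b ∧ z = t * c := by
  refine ⟨x / a, by field_simp, ?_⟩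
  have key : ∀ t : K, x = t * a → y = t * b ∧ z = t * c := by
    rintro t rfl
    have e1 : b * (y - t * b) + c * (z - t * c) = 0 := by linear_combination h1 - t * h0
    have e2 : (y - t * b) ^ 2 + (z - t * c) ^ 2 = 0 := by
      linear_combination h2 - 2 * t * h1 + t ^ 2 * h0
    have e3 : a ^ 2 * (y - t * b) ^ 2 = 0 := by
      linear_combination (y - t * b) ^ 2 * h0 - (b * (y - t * b) - c * (z - t * c)) * e1 - c ^ 2 * e2
    have e4 : y - t * b = 0 := by simpa [ha] using e3
    rw [e4] at e2
    have e5 : z - t * c = 0 := by simpa using e2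
    exact ⟨sub_eq_zero.1 e4, sub_eq_zero.1 e5⟩
  exact key _ (by field_simp)

lemma iso {v0 v1 : Fin 3 → K} (h0 : v0 ⬝ᵥ v0 = 0) (h1 : v0 ⬝ᵥ v1 = 0) (h2 : v1 ⬝ᵥ v1 = 0)
    (hne : v0 ≠ 0) : ∃ t : K, v1 = t • v0 := by
  simp only [dotProduct, Fin.sum_univ_three] at h0 h1 h2
  obtain ⟨i, hi⟩ := Function.ne_iff.1 hne
  simp only [Pi.zero_apply] at hi
  have fin : ∀ t, v1 0 = t * v0 0 → v1 1 = t * v0 1 → v1 2 = t * v0 2 → v1 = t • v0 := by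
    intro t a b c
    ext j
    fin_cases j <;> simpa
  have hcase : v0 0 ≠ 0 ∨ v0 1 ≠ 0 ∨ v0 2 ≠ 0 := by
    fin_cases i
    · exact Or.inl hi
    · exact Or.inr (Or.inl hi)
    · exact Or.inr (Or.inr hi)
  rcases hcase with hi | hi | hi
  · obtain ⟨t, a, b, c⟩ := iso_aux hi h0 h1 h2
    exact ⟨t, fin t a b c⟩
  · obtain ⟨t, a, b, c⟩ := iso_aux (x := v1 1) (b := v0 0) (y := v1 0) (c := v0 2) (z := v1 2) hi
      (by linear_combination h0) (by linear_combination h1) (by linear_combination h2)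
    exact ⟨t, fin t b a c⟩
  · obtain ⟨t, a, b, c⟩ := iso_aux (x := v1 2) (b := v0 0) (y := v1 0) (c := v0 1) (z := v1 1) hi
      (by linear_combination h0) (by linear_combination h1) (by linear_combination h2)
    exact ⟨t, fin t b c a⟩

lemma vec_main [CharZero K] (v : ℕ → Fin 3 → K) (hv2 : v 2 = 0)
    (h : ∀ n, ∑ p ∈ Finset.HasAntidiagonal.antidiagonal n, v p.1 ⬝ᵥ v p.2 = 0) :
    v 0 ⬝ᵥ v 4 = 0 ∧ v 0 ⬝ᵥ v 5 = 0 := by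
  have H0 := h 0
  have H1 := h 1
  have H2 := h 2
  have H3 := h 3
  have H4 := h 4
  have H5 := h 5
  simp [Finset.Nat.antidiagonal_succ, hv2] at H0 H1 H2 H3 H4 H5
  by_cases hne : v 0 = 0
  · simp [hne]
  have c10 := dotProduct_comm (v 1) (v 0)
  have c30 := dotProduct_comm (v 3) (v 0)
  have c31 := dotProduct_comm (v 3) (v 1)
  have c40 := dotProduct_comm (v 4) (v 0)
  have c41 := dotProduct_comm (v 4) (v 1)
  have c50 := dotProduct_comm (v 5) (v 0)
  have k01 : v 0 ⬝ᵥ v 1 = 0 := by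
    have : 2 * (v 0 ⬝ᵥ v 1) = 0 := by linear_combination H1 - c10
    simpa using this
  have k03 : v 0 ⬝ᵥ v 3 = 0 := by
    have : 2 * (v 0 ⬝ᵥ v 3) = 0 := by linear_combination H3 - c30
    simpa using this
  have k11 : v 1 ⬝ᵥ v 1 = 0 := by linear_combination H2
  obtain ⟨t, ht⟩ := iso H0 k01 k11 hne
  have k13 : v 1 ⬝ᵥ v 3 = 0 := by rw [ht, smul_dotProduct, k03, smul_zero]
  have k04 : v 0 ⬝ᵥ v 4 = 0 := by
    have : 2 * (v 0 ⬝ᵥ v 4) = 0 := by linear_combination H4 - c40 - c31 - 2 * k13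
    simpa using this
  have k14 : v 1 ⬝ᵥ v 4 = 0 := by rw [ht, smul_dotProduct, k04, smul_zero]
  have k05 : v 0 ⬝ᵥ v 5 = 0 := by
    have : 2 * (v 0 ⬝ᵥ v 5) = 0 := by linear_combination H5 - c50 - c41 - 2 * k14
    simpa using this
  exact ⟨k04, k05⟩

lemma DD_GS [CharZero K] {q : MvPolynomial (Sg d) K} (hq : q ∈ GS K d) (a b : Sg d)
    (ha : (a.1 : ℕ) = 0) (hb : (b.1 : ℕ) = 4 ∨ (b.1 : ℕ) = 5) : DD a b q = 0 := by
  obtain ⟨h1, -, l, hl, rfl⟩ := hq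
  have hp := ps_of_mem h1
  have := vec_main (fun n i => (ps K d (l i)).coeff n) (by ext i; exact lin_ps2 (hl i)) (by
    intro n
    have := congrArg (fun P => Polynomial.coeff P n) hp
    simp only [map_sum, Polynomial.finsetSum_coeff, sq, map_mul, Polynomial.coeff_mul,
      Polynomial.coeff_zero] at this
    simp only [dotProduct]
    rw [Finset.sum_comm]
    exact this)
  simp only [dotProduct] at this
  rw [map_sum]
  simp only [DD_sq (hl _), ha, ← Finset.mul_sum]
  rcases hb with hb | hb <;> simp [hb, this]

lemma DD_mul_GS {q p : MvPolynomial (Sg d) K} (hq : rankLE 3 q) (a b : Sg d)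
    (h : DD a b q = 0) : DD a b (p * q) = 0 := by
  have z0 : c0 q = 0 := by
    obtain ⟨l, hl, rfl⟩ := hq
    simp [lin_c0 (hl _)]
  have z1 : ∀ a, c0 (pderiv a q) = 0 := by
    obtain ⟨l, hl, rfl⟩ := hq
    intro a
    simp only [map_sum, sq, pderiv_mul, map_add, map_mul, lin_c0 (hl _)]
    simp
  rw [DD_apply] at h ⊢
  simp only [pderiv_mul, map_add, map_mul, z0, z1, h]
  simp

lemma mem_e {a b u v : ℕ} (h : a + b = u + v) (ha : a ≤ d ∧ a ≠ 2) (hb : b ≤ d ∧ b ≠ 2)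
    (hu : u ≤ d ∧ u ≠ 2) (hv : v ≤ d ∧ v ≠ 2) :
    xx K d a * xx K d b - xx K d u * xx K d v ∈ quadComp K d 2 := by
  refine ⟨?_, ((hom_xx _).mul (hom_xx _)).sub ((hom_xx _).mul (hom_xx _))⟩
  change ph K d _ = 0
  rw [map_sub, ph_mul h ha hb, ph_mul rfl hu hv, sub_self]

end

end QR

open QR in
theorem stmt9 {K : Type*} [Field K] [IsAlgClosed K] [CharZero K]
    (d : ℕ) (hd : 5 ≤ d) :
    Module.finrank K (Submodule.span K
        {q : MvPolynomial {m : Fin (d + 1) // (m : ℕ) ≠ 2} K |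
          q ∈ projIdeal K d 2 ∧ q.IsHomogeneous 2 ∧ rankLE 3 q}) + 2
      = Module.finrank K (quadComp K d 2)
    ∧ ¬ ∃ S : Set (MvPolynomial {m : Fin (d + 1) // (m : ℕ) ≠ 2} K),
        (∀ q ∈ S, q.IsHomogeneous 2 ∧ rankLE 3 q) ∧
        Ideal.span S = Ideal.span (quadComp K d 2 : Set _) := by
  classical
  have hx : ∀ m (h : m < d + 1) (h2 : m ≠ 2), xx K d m = X (⟨⟨m, h⟩, h2⟩ : Sg d) :=
    fun m h h2 => dif_pos ⟨h, h2⟩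
  obtain ⟨i0, hi0⟩ : ∃ i : Sg d, (i.1 : ℕ) = 0 := ⟨⟨⟨0, by omega⟩, by simp⟩, rfl⟩
  obtain ⟨i1, hi1⟩ : ∃ i : Sg d, (i.1 : ℕ) = 1 := ⟨⟨⟨1, by omega⟩, by simp⟩, rfl⟩
  obtain ⟨i3, hi3⟩ : ∃ i : Sg d, (i.1 : ℕ) = 3 := ⟨⟨⟨3, by omega⟩, by simp⟩, rfl⟩
  obtain ⟨i4, hi4⟩ : ∃ i : Sg d, (i.1 : ℕ) = 4 := ⟨⟨⟨4, by omega⟩, by simp⟩, rfl⟩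
  obtain ⟨i5, hi5⟩ : ∃ i : Sg d, (i.1 : ℕ) = 5 := ⟨⟨⟨5, by omega⟩, by simp⟩, rfl⟩
  have ne : ∀ i j : Sg d, (i.1 : ℕ) ≠ (j.1 : ℕ) → i ≠ j := fun i j h e => h (by rw [e])
  have x0 := X_eq (K := K) i0
  have x1 := X_eq (K := K) i1
  have x3 := X_eq (K := K) i3
  have x4 := X_eq (K := K) i4
  have x5 := X_eq (K := K) i5
  rw [hi0] at x0
  rw [hi1] at x1
  rw [hi3] at x3
  rw [hi4] at x4
  rw [hi5] at x5
  obtain ⟨e1, he1⟩ : ∃ e, e = xx K d 0 * xx K d 4 - xx K d 1 * xx K d 3 := ⟨_, rfl⟩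
  obtain ⟨e2, he2⟩ : ∃ e, e = xx K d 0 * xx K d 5 - xx K d 1 * xx K d 4 := ⟨_, rfl⟩
  have m1 : e1 ∈ quadComp K d 2 := by rw [he1]; apply mem_e <;> omega
  have m2 : e2 ∈ quadComp K d 2 := by rw [he2]; apply mem_e <;> omega
  have n01 := ne i0 i1 (by omega)
  have n03 := ne i0 i3 (by omega)
  have n04 := ne i0 i4 (by omega)
  have n05 := ne i0 i5 (by omega)
  have n14 := ne i1 i4 (by omega)
  have n15 := ne i1 i5 (by omega)
  have n34 := ne i3 i4 (by omega)
  have n35 := ne i3 i5 (by omega)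
  have n45 := ne i4 i5 (by omega)
  have a1 : DD i0 i4 e1 = 1 := by
    rw [he1, ← x0, ← x1, ← x3, ← x4, DD_apply]
    simp [pderiv_mul, pderiv_X, n01, n03, n04, n14, n34, n01.symm, n03.symm, n04.symm, n14.symm,
      n34.symm]
  have a2 : DD i0 i4 e2 = 0 := by
    rw [he2, ← x0, ← x1, ← x5, ← x4, DD_apply]
    simp [pderiv_mul, pderiv_X, n01, n05, n04, n14, n45, n01.symm, n05.symm, n04.symm, n14.symm,
      n45.symm]
  have b1 : DD i0 i5 e1 = 0 := by
    rw [he1, ← x0, ← x1, ← x3, ← x4, DD_apply]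
    simp [pderiv_mul, pderiv_X, n05, n15, n35, n45, n05.symm, n15.symm, n35.symm, n45.symm]
  have b2 : DD i0 i5 e2 = 1 := by
    rw [he2, ← x0, ← x1, ← x5, ← x4, DD_apply]
    simp [pderiv_mul, pderiv_X, n01, n05, n04, n15, n45, n01.symm, n05.symm, n04.symm, n15.symm,
      n45.symm]
  have hV4 : VV K d ≤ LinearMap.ker (DD i0 i4) :=
    Submodule.span_le.2 fun q hq => DD_GS hq i0 i4 hi0 (Or.inl hi4)
  have hV5 : VV K d ≤ LinearMap.ker (DD i0 i5) :=
    Submodule.span_le.2 fun q hq => DD_GS hq i0 i5 hi0 (Or.inr hi5)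
  constructor
  · change Module.finrank K (VV K d) + 2 = _
    have : Module.Finite K (homogeneousSubmodule (Sg d) K 2) :=
      Module.Finite.iff_fg.2 (homogeneousSubmodule_fg _ _ 2)
    have : Module.Finite K (quadComp K d 2) :=
      Submodule.finiteDimensional_of_le
        (inf_le_right : quadComp K d 2 ≤ homogeneousSubmodule (Sg d) K 2)
    let f : quadComp K d 2 →ₗ[K] K × K :=
      ((DD i0 i4).prod (DD i0 i5)).comp (quadComp K d 2).subtype
    have hf : ∀ q, f q = (DD i0 i4 q.1, DD i0 i5 q.1) := fun q => rfl
    have surj : LinearMap.range f = ⊤ := by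
      rw [LinearMap.range_eq_top]
      rintro ⟨r, s⟩
      refine ⟨r • ⟨e1, m1⟩ + s • ⟨e2, m2⟩, ?_⟩
      rw [map_add, map_smul, map_smul, hf, hf]
      simp [a1, a2, b1, b2]
    have hker : LinearMap.ker f = (VV K d).comap (quadComp K d 2).subtype := by
      ext ⟨q, hq⟩
      rw [LinearMap.mem_ker, hf, Submodule.mem_comap, Prod.mk_eq_zero]
      constructor
      · rintro ⟨k1, k2⟩
        obtain ⟨v, hv, w, hw, rfl⟩ := Submodule.mem_sup.1 (quad_le hq)
        rw [← he1, ← he2] at hw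
        obtain ⟨r, s, rfl⟩ := Submodule.mem_span_pair.1 hw
        have z4 : DD i0 i4 v = 0 := hV4 hv
        have z5 : DD i0 i5 v = 0 := hV5 hv
        simp only [map_add, map_smul, a1, a2, b1, b2, z4, z5] at k1 k2
        have r0 : r = 0 := by simpa using k1
        have s0 : s = 0 := by simpa using k2
        simpa [r0, s0] using hv
      · intro h
        exact ⟨hV4 h, hV5 h⟩
    have rn := LinearMap.finrank_range_add_finrank_ker f
    rw [surj, hker, finrank_top, Module.finrank_prod, Module.finrank_self,
      (Submodule.comapSubtypeEquivOfLe VV_le).finrank_eq] at rn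
    omega
  · rintro ⟨S, hS, hspan⟩
    have hle : Ideal.span (quadComp K d 2 : Set (MvPolynomial (Sg d) K)) ≤ projIdeal K d 2 :=
      Ideal.span_le.2 fun q hq => hq.1
    have hSG : ∀ q ∈ S, q ∈ GS K d := fun q hq =>
      ⟨hle (hspan ▸ Ideal.subset_span hq), (hS q hq).1, (hS q hq).2⟩
    have he : e1 ∈ Ideal.span S := by rw [hspan]; exact Ideal.subset_span m1
    obtain ⟨n, g, s, hsum⟩ := Submodule.mem_span_set'.1 he
    have : DD i0 i4 e1 = 0 := by
      rw [← hsum, map_sum]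
      refine Finset.sum_eq_zero fun i _ => ?_
      rw [smul_eq_mul]
      exact DD_mul_GS (hS _ (s i).2).2 _ _ (DD_GS (hSG _ (s i).2) i0 i4 hi0 (Or.inl hi4))
    rw [a1] at this
    exact one_ne_zero this
end
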